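/- arXiv:1907.04586 — 2 statements merged into one kernel-verified Lean document; each statement's English description precedes it below -/
import Mathlib

section
/- Let f_k(p) denote the maximum p-centered chromatic number over graphs of simple treewidth at most k. Then for every k ≥ 3 and p ≥ 1, f_k(p) ≤ (p+1)·f_{k-1}(p). More precisely: if every graph of simple treewidth at most k−1 admits a p-centered coloring with at most c colors, then every graph of simple treewidth at most k admits a p-centered coloring with at most (p+1)·c colors. -/
/-- A tree-decomposition of a graph `G`: a tree together with bags indexed by its nodes,
covering all vertices and edges, such that the set of nodes whose bag contains any given
vertex induces a (nonempty, by `vert_cover`) subtree. -/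
structure TreeDecomp {V : Type} (G : SimpleGraph V) where
  ι : Type
  tree : SimpleGraph ι
  tree_connected : tree.Connected
  tree_acyclic : tree.IsAcyclic
  bag : ι → Set V
  vert_cover : ∀ v : V, ∃ t : ι, v ∈ bag t
  edge_cover : ∀ ⦃u v : V⦄, G.Adj u v → ∃ t : ι, u ∈ bag t ∧ v ∈ bag t
  bag_subtree : ∀ v : V, (tree.induce {t : ι | v ∈ bag t}).Preconnected

/-- `G` has a tree-decomposition of width at most `k` (all bags of size at most `k+1`). -/
def HasTreewidthLE {V : Type} (G : SimpleGraph V) (k : ℕ) : Prop :=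
  ∃ D : TreeDecomp G, ∀ t, (D.bag t).ncard ≤ k + 1

/-- `G` has a `k`-simple tree-decomposition: width at most `k`, and every set of exactly
`k` vertices is contained in at most two distinct bags. -/
def HasSimpleTreewidthLE {V : Type} (G : SimpleGraph V) (k : ℕ) : Prop :=
  ∃ D : TreeDecomp G, (∀ t, (D.bag t).ncard ≤ k + 1) ∧
    ∀ X : Set V, X.ncard = k →
      ∀ t₁ t₂ t₃ : D.ι, X ⊆ D.bag t₁ → X ⊆ D.bag t₂ → X ⊆ D.bag t₃ →
        t₁ = t₂ ∨ t₁ = t₃ ∨ t₂ = t₃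

/-- The treewidth of `G`. -/
noncomputable def treewidth {V : Type} (G : SimpleGraph V) : ℕ :=
  sInf {k | HasTreewidthLE G k}

/-- The simple treewidth of `G`. -/
noncomputable def simpleTreewidth {V : Type} (G : SimpleGraph V) : ℕ :=
  sInf {k | HasSimpleTreewidthLE G k}

/-- A vertex coloring `φ` of a graph `G` is `p`-centered if for every connected subgraph `H`
of `G`, either `φ` uses more than `p` colors on `H` or some color appears exactly once on `H`. -/
def IsPCentered {V C : Type} (G : SimpleGraph V) (p : ℕ) (φ : V → C) : Prop :=
  ∀ H : G.Subgraph, H.Connected →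
    p < (φ '' H.verts).ncard ∨ ∃ c : C, {v ∈ H.verts | φ v = c}.ncard = 1

/-- `S` is connected with respect to the relation `R` (cut formulation). -/
def Conn {α : Type} (R : α → α → Prop) (S : Set α) : Prop :=
  ∀ f : α → Prop, (∀ a ∈ S, ∀ b ∈ S, R a b → f a → f b) → ∀ a ∈ S, ∀ b ∈ S, f a → f b

/-- Families of sets having an ordering with the running intersection property. -/
inductive RIP {V : Type} : Set (Set V) → Prop
  | empty : RIP ∅
  | step (F : Set (Set V)) (B : Set V) (h : RIP F)
      (hB : B ∩ ⋃₀ F = ∅ ∨ ∃ P ∈ F, B ∩ ⋃₀ F ⊆ P) : RIP (insert B F)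

/-- Two elements share a member of the family. -/
def Share {V : Type} (F : Set (Set V)) (u v : V) : Prop := ∃ B ∈ F, u ∈ B ∧ v ∈ B

/-- The bottom part of a bag with respect to a layering. -/
def bot {V : Type} (L : V → ℕ) (B : Set V) : Set V := {v | v ∈ B ∧ ∃ u ∈ B, L u < L v}

theorem conn_of_preconnected {α : Type} {T : SimpleGraph α} {S : Set α}
    (h : (T.induce S).Preconnected) : Conn T.Adj S := by
  intro f hf a ha b hb hfa
  obtain ⟨w⟩ := h ⟨a, ha⟩ ⟨b, hb⟩
  have key : ∀ (x y : S), (T.induce S).Walk x y → f x → f y := by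
    intro x y w
    induction w with
    | nil => exact id
    | cons h _ ih => exact fun hx => ih (hf _ (Subtype.coe_prop _) _ (Subtype.coe_prop _) h hx)
  exact key _ _ w hfa

theorem preconnected_of_conn {α : Type} {T : SimpleGraph α} {S : Set α}
    (h : Conn T.Adj S) : (T.induce S).Preconnected := by
  rintro ⟨a, ha⟩ ⟨b, hb⟩
  have := h (fun x => ∃ hx : x ∈ S, (T.induce S).Reachable ⟨a, ha⟩ ⟨x, hx⟩) ?_ a ha b hb
    ⟨ha, SimpleGraph.Reachable.refl _⟩
  · exact this.2
  · rintro x hx y hy hxy ⟨_, hr⟩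
    refine ⟨hy, hr.trans ?_⟩
    apply SimpleGraph.Adj.reachable
    exact hxy

theorem Conn.mono {α : Type} {R R' : α → α → Prop} {S : Set α} (h : Conn R S)
    (hR : ∀ a ∈ S, ∀ b ∈ S, R a b → R' a b) : Conn R' S :=
  fun f hf => h f fun a ha b hb hab => hf a ha b hb (hR a ha b hb hab)

theorem conn_univ {α : Type} {T : SimpleGraph α} (h : T.Preconnected) : Conn T.Adj Set.univ := by
  intro f hf a _ b _ hfa
  obtain ⟨w⟩ := h a b
  induction w with
  | nil => exact hfa
  | cons h _ ih => exact ih trivial trivial (hf _ trivial _ trivial h hfa)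

theorem preconnected_of_conn_univ {α : Type} {T : SimpleGraph α}
    (h : Conn T.Adj Set.univ) : T.Preconnected := by
  intro a b
  refine h (fun x => T.Reachable a x) ?_ a trivial b trivial (SimpleGraph.Reachable.refl _)
  intro x _ y _ hxy hr
  exact hr.trans hxy.reachable

/-! ### From tree decompositions to RIP families -/

theorem bag_inter {V : Type} {G : SimpleGraph V} (D : TreeDecomp G) (F : Set D.ι)
    (hF : Conn D.tree.Adj F) {P t s : D.ι} (hP : P ∈ F) (ht : t ∉ F) (hadj : D.tree.Adj t P)
    (hs : s ∈ F) {v : V} (hvs : v ∈ D.bag s) (hvt : v ∈ D.bag t) : v ∈ D.bag P := by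
  by_contra hvP
  have hbr := SimpleGraph.isAcyclic_iff_forall_adj_isBridge.1 D.tree_acyclic hadj
  rw [SimpleGraph.isBridge_iff] at hbr
  apply hbr
  set T' := D.tree.deleteEdges {s(t, P)}
  have h1 : T'.Reachable t s := by
    refine conn_of_preconnected (D.bag_subtree v) (fun x => T'.Reachable t x) ?_ t hvt s hvs
      (SimpleGraph.Reachable.refl _)
    intro x hx y hy hxy hr
    refine hr.trans (SimpleGraph.Adj.reachable ?_)
    simp only [T', SimpleGraph.deleteEdges_adj, Set.mem_singleton_iff]
    refine ⟨hxy, ?_⟩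
    intro he
    have : P ∈ s(x, y) := by rw [he]; simp
    rcases Sym2.mem_iff.1 this with h | h
    · subst h; exact hvP hx
    · subst h; exact hvP hy
  refine hF (fun x => T'.Reachable t x) ?_ s hs P hP h1
  intro x hx y hy hxy hr
  refine hr.trans (SimpleGraph.Adj.reachable ?_)
  simp only [T', SimpleGraph.deleteEdges_adj, Set.mem_singleton_iff]
  refine ⟨hxy, ?_⟩
  intro he
  have : t ∈ s(x, y) := by rw [he]; simp
  rcases Sym2.mem_iff.1 this with h | h
  · subst h; exact ht hx
  · subst h; exact ht hy

theorem grow {V : Type} {G : SimpleGraph V} (D : TreeDecomp G) (l : List D.ι) (r : D.ι) :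
    ∃ F : Set D.ι, Conn D.tree.Adj F ∧ RIP (D.bag '' F) ∧ r ∈ F ∧ ∀ t ∈ l, t ∈ F := by
  induction l with
  | nil =>
    refine ⟨{r}, ?_, ?_, rfl, by simp⟩
    · rintro f - a rfl b rfl h; exact h
    · have := RIP.step ∅ (D.bag r) RIP.empty (Or.inl (by simp))
      simpa using this
  | cons t l ih =>
    obtain ⟨F0, h1, h2, h3, h4⟩ := ih
    have := conn_univ D.tree_connected.preconnected
      (fun x => ∃ F : Set D.ι, Conn D.tree.Adj F ∧ RIP (D.bag '' F) ∧ F0 ⊆ F ∧ x ∈ F) ?_ r trivial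
      t trivial ⟨F0, h1, h2, subset_rfl, h3⟩
    · obtain ⟨F, a1, a2, a3, a4⟩ := this
      refine ⟨F, a1, a2, a3 h3, ?_⟩
      intro s hs
      rcases List.mem_cons.1 hs with rfl | hs
      · exact a4
      · exact a3 (h4 _ hs)
    · rintro x - y - hxy ⟨F, a1, a2, a3, a4⟩
      by_cases hy : y ∈ F
      · exact ⟨F, a1, a2, a3, hy⟩
      refine ⟨insert y F, ?_, ?_, a3.trans (Set.subset_insert _ _), Set.mem_insert _ _⟩
      · intro f hf
        have hin := a1 f (fun a ha b hb => hf a (Set.mem_insert_of_mem _ ha) b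
          (Set.mem_insert_of_mem _ hb))
        have e1 := hf x (Set.mem_insert_of_mem _ a4) y (Set.mem_insert _ _) hxy
        have e2 := hf y (Set.mem_insert _ _) x (Set.mem_insert_of_mem _ a4) hxy.symm
        rintro a (rfl | ha) b (rfl | hb) h
        · exact h
        · exact hin _ a4 _ hb (e2 h)
        · exact e1 (hin _ ha _ a4 h)
        · exact hin _ ha _ hb h
      · rw [Set.image_insert_eq]
        refine RIP.step _ _ a2 (Or.inr ⟨D.bag x, ⟨x, a4, rfl⟩, ?_⟩)
        rintro v ⟨hv, _, ⟨s, hs, rfl⟩, hvs⟩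
        exact bag_inter D F a1 a4 hy hxy.symm hs hvs hv

theorem exists_rip {V : Type} [Fintype V] {G : SimpleGraph V} (D : TreeDecomp G) :
    ∃ F : Set (Set V), RIP F ∧ F ⊆ Set.range D.bag ∧ (∀ v, ∃ B ∈ F, v ∈ B) ∧
      ∀ u v, G.Adj u v → Share F u v := by
  classical
  obtain ⟨r⟩ := D.tree_connected.nonempty
  have h : ∀ q : V × V, ∃ t : D.ι, (q.1 = q.2 ∨ G.Adj q.1 q.2) → q.1 ∈ D.bag t ∧ q.2 ∈ D.bag t := by
    rintro ⟨u, v⟩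
    by_cases huv : u = v
    · subst huv
      obtain ⟨t, ht⟩ := D.vert_cover u
      exact ⟨t, fun _ => ⟨ht, ht⟩⟩
    by_cases ha : G.Adj u v
    · obtain ⟨t, ht⟩ := D.edge_cover ha
      exact ⟨t, fun _ => ht⟩
    · exact ⟨r, fun h => by rcases h with h | h <;> contradiction⟩
  choose g hg using h
  obtain ⟨F, -, h2, -, h4⟩ := grow D ((Finset.univ : Finset (V × V)).toList.map g) r
  have h5 : ∀ q, g q ∈ F := fun q => h4 _ (by simp)
  refine ⟨D.bag '' F, h2, by rintro _ ⟨t, -, rfl⟩; exact ⟨t, rfl⟩, ?_, ?_⟩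
  · intro v
    exact ⟨_, ⟨_, h5 (v, v), rfl⟩, (hg (v, v) (Or.inl rfl)).1⟩
  · intro u v huv
    exact ⟨_, ⟨_, h5 (u, v), rfl⟩, hg (u, v) (Or.inr huv)⟩

/-! ### From RIP families to tree decompositions with incomparable bags -/

/-- Adding a leaf `none` attached to `p`. -/
def addLeaf {ι : Type} (T : SimpleGraph ι) (p : ι) : SimpleGraph (Option ι) where
  Adj a b := (∃ s t, a = some s ∧ b = some t ∧ T.Adj s t) ∨ (a = none ∧ b = some p) ∨
    (a = some p ∧ b = none)
  symm := ⟨by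
    rintro a b (⟨s, t, rfl, rfl, h⟩ | ⟨rfl, rfl⟩ | ⟨rfl, rfl⟩)
    · exact Or.inl ⟨t, s, rfl, rfl, h.symm⟩
    · exact Or.inr (Or.inr ⟨rfl, rfl⟩)
    · exact Or.inr (Or.inl ⟨rfl, rfl⟩)⟩
  loopless := ⟨by
    rintro a (⟨s, t, rfl, h, h'⟩ | ⟨rfl, h⟩ | ⟨rfl, h⟩)
    · cases h; exact h'.ne rfl
    · cases h
    · cases h⟩

theorem addLeaf_acyclic {ι : Type} {T : SimpleGraph ι} (p : ι) (hT : T.IsAcyclic) :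
    (addLeaf T p).IsAcyclic := by
  rw [SimpleGraph.isAcyclic_iff_forall_adj_isBridge] at hT ⊢
  have leaf : (addLeaf T p).IsBridge s(none, some p) := by
    rw [SimpleGraph.isBridge_iff]
    intro hr
    obtain ⟨w⟩ := hr
    cases w with
    | cons h _ =>
      simp only [SimpleGraph.deleteEdges_adj, Set.mem_singleton_iff] at h
      obtain ⟨⟨s, t, h1, -⟩ | ⟨-, rfl⟩ | ⟨h1, -⟩, h'⟩ := h
      · cases h1
      · exact h' rfl
      · cases h1
  rintro a b (⟨s, t, rfl, rfl, h⟩ | ⟨rfl, rfl⟩ | ⟨rfl, rfl⟩)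
  · have hb := hT h
    rw [SimpleGraph.isBridge_iff] at hb ⊢
    intro hr
    apply hb
    obtain ⟨w⟩ := hr
    have key : ∀ (x y : Option ι),
        ((addLeaf T p).deleteEdges {s(some s, some t)}).Walk x y →
        (T.deleteEdges {s(s, t)}).Reachable (x.getD p) (y.getD p) := by
      intro x y w
      induction w with
      | nil => exact SimpleGraph.Reachable.refl _
      | cons h _ ih =>
        refine SimpleGraph.Reachable.trans ?_ ih
        simp only [SimpleGraph.deleteEdges_adj, Set.mem_singleton_iff] at h
        obtain ⟨⟨s', t', rfl, rfl, h1⟩ | ⟨rfl, rfl⟩ | ⟨rfl, rfl⟩, h'⟩ := h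
        · apply SimpleGraph.Adj.reachable
          simp only [SimpleGraph.deleteEdges_adj, Set.mem_singleton_iff, Option.getD_some]
          refine ⟨h1, fun he => h' ?_⟩
          have := congrArg (Sym2.map (some : ι → Option ι)) he
          simpa using this
        · exact SimpleGraph.Reachable.refl _
        · exact SimpleGraph.Reachable.refl _
    exact key _ _ w
  · exact leaf
  · rw [Sym2.eq_swap]; exact leaf

theorem addLeaf_conn {ι : Type} {T : SimpleGraph ι} (p : ι) {S : Set ι} (hS : Conn T.Adj S)
    (S' : Set (Option ι)) (h1 : ∀ s, some s ∈ S' ↔ s ∈ S) (h2 : none ∈ S' → ∀ s ∈ S, p ∈ S) :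
    Conn (addLeaf T p).Adj S' := by
  intro f hf
  have hin := hS (fun s => f (some s)) (fun a ha b hb hab =>
    hf _ ((h1 a).2 ha) _ ((h1 b).2 hb) (Or.inl ⟨a, b, rfl, rfl, hab⟩))
  rintro (_ | a) ha (_ | b) hb h
  · exact h
  · have hb' := (h1 b).1 hb
    have hp := h2 ha b hb'
    exact hin p hp b hb' (hf _ ha _ ((h1 p).2 hp) (Or.inr (Or.inl ⟨rfl, rfl⟩)) h)
  · have ha' := (h1 a).1 ha
    have hp := h2 hb a ha'
    exact hf _ ((h1 p).2 hp) _ hb (Or.inr (Or.inr ⟨rfl, rfl⟩)) (hin a ha' p hp h)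
  · exact hin a ((h1 a).1 ha) b ((h1 b).1 hb) h

theorem rip_to_tree {V : Type} {F : Set (Set V)} (h : RIP F) (hne : F.Nonempty) :
    ∃ (ι : Type) (T : SimpleGraph ι) (bag : ι → Set V), Nonempty ι ∧ Conn T.Adj Set.univ ∧
      T.IsAcyclic ∧ (∀ t, bag t ∈ F) ∧ (∀ B ∈ F, ∃ t, B ⊆ bag t) ∧
      (∀ s t, bag s ⊆ bag t → s = t) ∧ ∀ v, Conn T.Adj {t | v ∈ bag t} := by
  classical
  induction h with
  | empty => exact absurd hne (by simp)
  | step F B h hB ih =>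
    by_cases hF : F.Nonempty
    swap
    · rw [Set.not_nonempty_iff_eq_empty] at hF
      subst hF
      refine ⟨Unit, ⊥, fun _ => B, inferInstance, ?_, SimpleGraph.isAcyclic_bot, by simp, by simp,
        by simp, ?_⟩
      · intro f hf a _ b _ h; exact h
      · intro v f hf a _ b _ h; exact h
    obtain ⟨ι, T, bag, ⟨t0⟩, c1, c2, c3, c4, c5, c6⟩ := ih hF
    obtain ⟨p, hp⟩ : ∃ p, B ∩ ⋃₀ F ⊆ bag p := by
      rcases hB with hB | ⟨P, hP, hB⟩
      · exact ⟨t0, by simp [hB]⟩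
      · obtain ⟨p, hp⟩ := c4 P hP
        exact ⟨p, hB.trans hp⟩
    have hsub : ∀ t, bag t ⊆ ⋃₀ F := fun t => Set.subset_sUnion_of_mem (c3 t)
    by_cases k1 : ∃ t, B ⊆ bag t
    · refine ⟨ι, T, bag, ⟨t0⟩, c1, c2, fun t => Set.mem_insert_of_mem _ (c3 t), ?_, c5, c6⟩
      rintro C (rfl | hC)
      · exact k1
      · exact c4 C hC
    push Not at k1
    have hlow : ∀ t, bag t ⊆ B → t = p := fun t ht => c5 _ _ fun v hv => hp ⟨ht hv, hsub t hv⟩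
    by_cases k2 : ∃ t, bag t ⊆ B
    · obtain ⟨t, ht⟩ := k2
      have := hlow t ht
      subst this
      have hmem : ∀ v s, v ∈ Function.update bag t B s ↔ (v ∈ bag s ∨ (s = t ∧ v ∈ B)) := by
        intro v s
        by_cases hs : s = t
        · subst hs
          simp only [Function.update_self, true_and]
          exact ⟨Or.inr, fun h => h.elim (fun h => ht h) id⟩
        · simp [hs]
      refine ⟨ι, T, Function.update bag t B, ⟨t0⟩, c1, c2, ?_, ?_, ?_, ?_⟩
      · intro s
        by_cases hs : s = t
        · subst hs; simp
        · simp only [Function.update_of_ne hs]; exact Set.mem_insert_of_mem _ (c3 s)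
      · rintro C (rfl | hC)
        · exact ⟨t, by simp⟩
        · obtain ⟨s, hs⟩ := c4 C hC
          exact ⟨s, fun v hv => (hmem v s).2 (Or.inl (hs hv))⟩
      · intro a b hab
        by_cases ha : a = t
        · subst ha
          by_contra hb
          rw [Function.update_self, Function.update_of_ne (Ne.symm hb)] at hab
          exact k1 b hab
        · by_cases hb : b = t
          · subst hb
            rw [Function.update_self, Function.update_of_ne ha] at hab
            exact hlow a hab
          · rw [Function.update_of_ne ha, Function.update_of_ne hb] at hab
            exact c5 _ _ hab
      · intro v
        by_cases hv : v ∈ ⋃₀ F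
        · have : {s | v ∈ Function.update bag t B s} = {s | v ∈ bag s} := by
            ext s
            simp only [Set.mem_ofPred_eq, hmem]
            refine ⟨?_, Or.inl⟩
            rintro (h | ⟨rfl, h⟩)
            · exact h
            · exact hp ⟨h, hv⟩
          rw [this]; exact c6 v
        · have : ∀ s, v ∈ Function.update bag t B s → s = t := by
            intro s hs
            rcases (hmem v s).1 hs with h | h
            · exact absurd (hsub s h) hv
            · exact h.1
          intro f _ a ha b hb h
          rw [this b hb]; rw [this a ha] at h; exact h
    push Not at k2
    refine ⟨Option ι, addLeaf T p, fun o => o.elim B bag, ⟨none⟩, ?_, addLeaf_acyclic p c2,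
      ?_, ?_, ?_, ?_⟩
    · exact addLeaf_conn p c1 _ (by simp) (by simp)
    · rintro (_ | t)
      · exact Set.mem_insert _ _
      · exact Set.mem_insert_of_mem _ (c3 t)
    · rintro C (rfl | hC)
      · exact ⟨none, subset_rfl⟩
      · obtain ⟨s, hs⟩ := c4 C hC
        exact ⟨some s, hs⟩
    · rintro (_ | a) (_ | b) hab
      · rfl
      · exact absurd hab (k1 b)
      · exact absurd hab (k2 a)
      · rw [c5 a b hab]
    · intro v
      refine addLeaf_conn p (c6 v) _ (fun s => Iff.rfl) ?_
      intro hn s hs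
      exact hp ⟨hn, hsub s hs⟩

/-! ### Layerings -/

/-- The properties of the layering built along a RIP family. -/
structure Good {V : Type} (F : Set (Set V)) (L : V → ℕ) : Prop where
  lay : ∀ B ∈ F, ∀ u ∈ B, ∀ v ∈ B, L v ≤ L u + 1
  rip : RIP (bot L '' F)
  first : ∀ X : Set V, X.Nonempty → (∃ B ∈ F, X ⊆ bot L B) →
    ∃ C ∈ F, X ⊆ bot L C ∧ ∀ B ∈ F, X ⊆ bot L B → B \ bot L B ⊆ C \ bot L C
  conn : ∀ S : Set V, S ⊆ ⋃₀ F → Conn (Share F) S → ∀ i, (∀ s ∈ S, i ≤ L s) →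
    Conn (Share (bot L '' F)) (S ∩ {v | L v = i})

theorem bot_congr {V : Type} {L L' : V → ℕ} {B : Set V} (h : ∀ v ∈ B, L' v = L v) :
    bot L' B = bot L B := by
  ext v
  constructor
  · rintro ⟨hv, u, hu, huv⟩
    exact ⟨hv, u, hu, by rwa [← h u hu, ← h v hv]⟩
  · rintro ⟨hv, u, hu, huv⟩
    exact ⟨hv, u, hu, by rwa [h u hu, h v hv]⟩

theorem bot_subset {V : Type} (L : V → ℕ) (B : Set V) : bot L B ⊆ B := fun _ h => h.1

theorem Good.congr {V : Type} {F : Set (Set V)} {L L' : V → ℕ} (h : Good F L)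
    (hL : ∀ v ∈ ⋃₀ F, L' v = L v) : Good F L' := by
  have hb : ∀ B ∈ F, bot L' B = bot L B := fun B hB => bot_congr fun v hv => hL v ⟨B, hB, hv⟩
  have him : bot L' '' F = bot L '' F := Set.image_congr hb
  refine ⟨?_, ?_, ?_, ?_⟩
  · intro B hB u hu v hv
    rw [hL u ⟨B, hB, hu⟩, hL v ⟨B, hB, hv⟩]
    exact h.lay B hB u hu v hv
  · rw [him]; exact h.rip
  · rintro X hX ⟨B, hB, hXB⟩
    obtain ⟨C, hC, h1, h2⟩ := h.first X hX ⟨B, hB, by rwa [← hb B hB]⟩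
    refine ⟨C, hC, by rwa [hb C hC], fun B' hB' hX' => ?_⟩
    rw [hb C hC, hb B' hB']
    exact h2 B' hB' (by rwa [← hb B' hB'])
  · intro S hS hc i hi
    have : S ∩ {v | L' v = i} = S ∩ {v | L v = i} := by
      ext v
      constructor
      · rintro ⟨a, b⟩; exact ⟨a, (hL v (hS a)).symm.trans b⟩
      · rintro ⟨a, b⟩; exact ⟨a, (hL v (hS a)).trans b⟩
    rw [this, him]
    exact h.conn S hS hc i fun s hs => by rw [← hL s (hS hs)]; exact hi s hs

theorem Good.single {V : Type} {F : Set (Set V)} {L : V → ℕ} (h : Good F L) (r : V)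
    (hr : r ∉ ⋃₀ F) : Good (insert {r} F) L := by
  have hbot : bot L {r} = ∅ := by
    ext v
    simp only [Set.mem_empty_iff_false, iff_false]
    rintro ⟨rfl, u, rfl, hu⟩
    exact lt_irrefl _ hu
  refine ⟨?_, ?_, ?_, ?_⟩
  · rintro B (rfl | hB) u hu v hv
    · cases hu; cases hv; omega
    · exact h.lay B hB u hu v hv
  · rw [Set.image_insert_eq, hbot]
    exact RIP.step _ _ h.rip (Or.inl (by simp))
  · rintro X hX ⟨B, hB, hXB⟩
    have key : ∀ B ∈ insert {r} F, X ⊆ bot L B → B ∈ F := by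
      rintro B (rfl | hB) hXB
      · rw [hbot] at hXB
        obtain ⟨x, hx⟩ := hX
        exact absurd (hXB hx) (by simp)
      · exact hB
    obtain ⟨C, hC, h1, h2⟩ := h.first X hX ⟨B, key B hB hXB, hXB⟩
    exact ⟨C, Set.mem_insert_of_mem _ hC, h1, fun B' hB' hX' => h2 B' (key B' hB' hX') hX'⟩
  · intro S hS hc i hi
    by_cases hrS : r ∈ S
    · have hall : ∀ b ∈ S, b = r := by
        intro b hb
        refine hc (fun x => x = r) ?_ r hrS b hb rfl
        rintro x hx y hy ⟨B, rfl | hB, hxB, hyB⟩ rfl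
        · exact hyB
        · exact absurd ⟨B, hB, hxB⟩ hr
      intro f _ a ha b hb hf
      rw [hall b hb.1]; rw [hall a ha.1] at hf; exact hf
    · have hS' : S ⊆ ⋃₀ F := by
        intro x hx
        obtain ⟨B, rfl | hB, hxB⟩ := hS hx
        · cases hxB; exact absurd hx hrS
        · exact ⟨B, hB, hxB⟩
      have hc' : Conn (Share F) S := by
        refine hc.mono ?_
        rintro a ha b hb ⟨B, rfl | hB, hxB, hyB⟩
        · cases hxB; exact absurd ha hrS
        · exact ⟨B, hB, hxB, hyB⟩
      refine (h.conn S hS' hc' i hi).mono ?_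
      rintro a _ b _ ⟨B, hB, h1, h2⟩
      exact ⟨B, Set.image_mono (Set.subset_insert _ _) hB, h1, h2⟩

theorem Good.attach {V : Type} {F : Set (Set V)} {L : V → ℕ} (h : Good F L) (B P : Set V)
    (hP : P ∈ F) (hBP : B ∩ ⋃₀ F ⊆ P) (a0 : V) (ha0 : a0 ∈ B ∩ ⋃₀ F)
    (hmin : ∀ a ∈ B ∩ ⋃₀ F, L a0 ≤ L a) (hN : ∀ n ∈ B, n ∉ ⋃₀ F → L n = L a0 + 1) :
    Good (insert B F) L := by
  have hPU : P ⊆ ⋃₀ F := Set.subset_sUnion_of_mem hP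
  have hlo : ∀ v ∈ B, L a0 ≤ L v := by
    intro v hv
    by_cases hvU : v ∈ ⋃₀ F
    · exact hmin v ⟨hv, hvU⟩
    · rw [hN v hv hvU]; omega
  have hhi : ∀ v ∈ B, L v ≤ L a0 + 1 := by
    intro v hv
    by_cases hvU : v ∈ ⋃₀ F
    · exact h.lay P hP _ (hBP ha0) _ (hBP ⟨hv, hvU⟩)
    · rw [hN v hv hvU]
  have hbotB : ∀ v, v ∈ bot L B ↔ v ∈ B ∧ L v = L a0 + 1 := by
    intro v
    constructor
    · rintro ⟨hv, u, hu, huv⟩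
      have := hlo u hu; have := hhi v hv
      exact ⟨hv, by omega⟩
    · rintro ⟨hv, hL⟩
      exact ⟨hv, a0, ha0.1, by omega⟩
  have hbotP : bot L B ∩ ⋃₀ F ⊆ bot L P := by
    rintro v ⟨hv, hvU⟩
    have := (hbotB v).1 hv
    exact ⟨hBP ⟨this.1, hvU⟩, a0, hBP ha0, by omega⟩
  refine ⟨?_, ?_, ?_, ?_⟩
  · rintro C (rfl | hC) u hu v hv
    · have := hlo u hu; have := hhi v hv; omega
    · exact h.lay C hC u hu v hv
  · rw [Set.image_insert_eq]
    refine RIP.step _ _ h.rip (Or.inr ⟨bot L P, ⟨P, hP, rfl⟩, ?_⟩)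
    rintro v ⟨hv, _, ⟨C, hC, rfl⟩, hvC⟩
    exact hbotP ⟨hv, C, hC, hvC.1⟩
  · rintro X hX ⟨C, hC, hXC⟩
    by_cases hXB : X ⊆ bot L B
    · by_cases hXU : X ⊆ ⋃₀ F
      · have hXP : X ⊆ bot L P := fun x hx => hbotP ⟨hXB hx, hXU hx⟩
        obtain ⟨C, hC, h1, h2⟩ := h.first X hX ⟨P, hP, hXP⟩
        refine ⟨C, Set.mem_insert_of_mem _ hC, h1, ?_⟩
        rintro B' (rfl | hB') hX'
        · refine subset_trans ?_ (h2 P hP hXP)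
          rintro v ⟨hv, hvb⟩
          have hLv : L v = L a0 := by
            have := hlo v hv; have := hhi v hv
            by_contra hne
            exact hvb ((hbotB v).2 ⟨hv, by omega⟩)
          have hvU : v ∈ ⋃₀ F := by
            by_contra hvU
            have := hN v hv hvU
            omega
          refine ⟨hBP ⟨hv, hvU⟩, ?_⟩
          rintro ⟨_, w, hw, hwv⟩
          obtain ⟨x, hx⟩ := hX
          have e1 := ((hbotB x).1 (hXB hx)).2
          have e2 := h.lay P hP w hw x (hXP hx).1
          omega
        · exact h2 B' hB' hX'
      · refine ⟨B, Set.mem_insert _ _, hXB, ?_⟩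
        rintro B' (rfl | hB') hX'
        · exact subset_rfl
        · exact absurd (fun x hx => ⟨B', hB', (hX' hx).1⟩) hXU
    · have key : ∀ C ∈ insert B F, X ⊆ bot L C → C ∈ F := by
        rintro C (rfl | hC) hXC
        · exact absurd hXC hXB
        · exact hC
      obtain ⟨D, hD, h1, h2⟩ := h.first X hX ⟨C, key C hC hXC, hXC⟩
      exact ⟨D, Set.mem_insert_of_mem _ hD, h1, fun B' hB' hX' => h2 B' (key B' hB' hX') hX'⟩
  · intro S hS hc i hi
    have hSB : ∀ x ∈ S, x ∉ ⋃₀ F → x ∈ B := by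
      intro x hx hxU
      obtain ⟨C, rfl | hC, hxC⟩ := hS hx
      · exact hxC
      · exact absurd ⟨C, hC, hxC⟩ hxU
    have hshB : ∀ x ∈ bot L B, ∀ y ∈ bot L B, Share (bot L '' insert B F) x y :=
      fun x hx y hy => ⟨_, ⟨B, Set.mem_insert _ _, rfl⟩, hx, hy⟩
    by_cases hSU : ∃ x ∈ S, x ∈ ⋃₀ F
    swap
    · push Not at hSU
      intro f hf a ha b hb hfa
      have hbb : ∀ x ∈ S, x ∈ bot L B := fun x hx =>
        (hbotB x).2 ⟨hSB x hx (hSU x hx), hN x (hSB x hx (hSU x hx)) (hSU x hx)⟩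
      exact hf a ha b hb (hshB a (hbb a ha.1) b (hbb b hb.1)) hfa
    obtain ⟨x0, hx0, hx0U⟩ := hSU
    have hcU : Conn (Share F) (S ∩ ⋃₀ F) := by
      intro f hf a ha b hb hfa
      have hA : ∀ x y, x ∈ S → y ∈ S → x ∈ B ∩ ⋃₀ F → y ∈ B ∩ ⋃₀ F → f x → f y :=
        fun x y hx hy hx' hy' => hf x ⟨hx, hx'.2⟩ y ⟨hy, hy'.2⟩ ⟨P, hP, hBP hx', hBP hy'⟩
      have := hc (fun v => (v ∈ ⋃₀ F ∧ f v) ∨ (v ∉ ⋃₀ F ∧ ∃ a' ∈ S, a' ∈ B ∩ ⋃₀ F ∧ f a')) ?_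
        a ha.1 b hb.1 (Or.inl ⟨ha.2, hfa⟩)
      · rcases this with h | h
        · exact h.2
        · exact absurd hb.2 h.1
      · rintro x hx y hy ⟨C, rfl | hC, hxC, hyC⟩ hfx
        · by_cases hyU : y ∈ ⋃₀ F
          · left
            refine ⟨hyU, ?_⟩
            rcases hfx with ⟨h1, h2⟩ | ⟨h1, a', h2, h3, h4⟩
            · exact hA x y hx hy ⟨hxC, h1⟩ ⟨hyC, hyU⟩ h2
            · exact hA a' y h2 hy h3 ⟨hyC, hyU⟩ h4
          · right
            refine ⟨hyU, ?_⟩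
            rcases hfx with ⟨h1, h2⟩ | ⟨h1, h2⟩
            · exact ⟨x, hx, ⟨hxC, h1⟩, h2⟩
            · exact h2
        · have hxU : x ∈ ⋃₀ F := ⟨C, hC, hxC⟩
          have hyU : y ∈ ⋃₀ F := ⟨C, hC, hyC⟩
          rcases hfx with ⟨h1, h2⟩ | ⟨h1, h2⟩
          · exact Or.inl ⟨hyU, hf x ⟨hx, hxU⟩ y ⟨hy, hyU⟩ ⟨C, hC, hxC, hyC⟩ h2⟩
          · exact absurd hxU h1
    have ih := h.conn _ Set.inter_subset_right hcU i (fun s hs => hi s hs.1)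
    intro f hf
    have hold : ∀ a ∈ S ∩ {v | L v = i}, ∀ b ∈ S ∩ {v | L v = i}, a ∈ ⋃₀ F → b ∈ ⋃₀ F →
        f a → f b := by
      intro a ha b hb haU hbU
      refine ih f ?_ a ⟨⟨ha.1, haU⟩, ha.2⟩ b ⟨⟨hb.1, hbU⟩, hb.2⟩
      rintro x hx y hy ⟨C, hC, h1, h2⟩
      exact hf x ⟨hx.1.1, hx.2⟩ y ⟨hy.1.1, hy.2⟩
        ⟨C, Set.image_mono (Set.subset_insert _ _) hC, h1, h2⟩
    -- a link between new and old vertices of the layer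
    have hlink : ∀ n ∈ S ∩ {v | L v = i}, n ∉ ⋃₀ F → ∃ a' ∈ S ∩ {v | L v = i}, a' ∈ ⋃₀ F ∧
        (f n → f a') ∧ (f a' → f n) := by
      rintro n ⟨hnS, hni⟩ hnU
      have hnB := hSB n hnS hnU
      have hn1 := hN n hnB hnU
      have hni' : L n = i := hni
      obtain ⟨a', haS, haB, haU⟩ : ∃ a' ∈ S, a' ∈ B ∧ a' ∈ ⋃₀ F := by
        by_contra hno
        push Not at hno
        refine hc (fun x => x ∉ ⋃₀ F) ?_ n hnS x0 hx0 hnU hx0U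
        rintro x hx y hy ⟨C, rfl | hC, hxC, hyC⟩ hxU
        · exact hno y hy hyC
        · exact absurd ⟨C, hC, hxC⟩ hxU
      have e1 := hi a' haS
      have e2 := hhi a' haB
      have e3 : L a' = i := by omega
      have s1 : a' ∈ bot L B := (hbotB a').2 ⟨haB, by omega⟩
      have s2 : n ∈ bot L B := (hbotB n).2 ⟨hnB, by omega⟩
      exact ⟨a', ⟨haS, e3⟩, haU, hf n ⟨hnS, hni⟩ a' ⟨haS, e3⟩ (hshB _ s2 _ s1),
        hf a' ⟨haS, e3⟩ n ⟨hnS, hni⟩ (hshB _ s1 _ s2)⟩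
    have hlink' : ∀ n ∈ S ∩ {v | L v = i}, ∃ a' ∈ S ∩ {v | L v = i}, a' ∈ ⋃₀ F ∧
        (f n → f a') ∧ (f a' → f n) := by
      intro n hn
      by_cases hnU : n ∈ ⋃₀ F
      · exact ⟨n, hn, hnU, id, id⟩
      · exact hlink n hn hnU
    intro a ha b hb hfa
    obtain ⟨a', ha', haU, h1, -⟩ := hlink' a ha
    obtain ⟨b', hb', hbU, -, h2⟩ := hlink' b hb
    exact h2 (hold a' ha' b' hb' haU hbU (h1 hfa))

theorem exists_min {V : Type} (L : V → ℕ) (A : Set V) (hA : A.Nonempty) :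
    ∃ a ∈ A, ∀ b ∈ A, L a ≤ L b := by
  obtain ⟨a, ha, h⟩ := WellFounded.has_min (measure L).wf A hA
  exact ⟨a, ha, fun b hb => not_lt.1 (h b hb)⟩

theorem Good.attach' {V : Type} {F : Set (Set V)} {L : V → ℕ} (h : Good F L) (B P : Set V)
    (hP : P ∈ F) (hBP : B ∩ ⋃₀ F ⊆ P) (hne : (B ∩ ⋃₀ F).Nonempty) :
    ∃ L', Good (insert B F) L' := by
  classical
  obtain ⟨a0, ha0, hmin⟩ := exists_min L _ hne
  have hL : ∀ v ∈ ⋃₀ F, (fun v => if v ∈ ⋃₀ F then L v else L a0 + 1) v = L v := by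
    intro v hv
    exact if_pos hv
  refine ⟨_, (h.congr hL).attach B P hP hBP a0 ha0 ?_ ?_⟩
  · intro a ha
    simp only [if_pos ha0.2, if_pos ha.2]
    exact hmin a ha
  · intro n _ hn
    simp only [if_pos ha0.2, if_neg hn]

theorem exists_good {V : Type} {F : Set (Set V)} (h : RIP F) :
    ∃ F' L, Good F' L ∧ (∀ B ∈ F, B.Nonempty → B ∈ F') ∧
      (∀ B ∈ F', B ∈ F ∨ ∃ v, B = {v}) ∧ ⋃₀ F' = ⋃₀ F := by
  induction h with
  | empty =>
    refine ⟨∅, fun _ => 0, ⟨by simp, by simpa using RIP.empty, by simp, ?_⟩, by simp, by simp, rfl⟩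
    intro S hS _ i _ f _ a ha
    exact absurd (hS ha.1) (by simp)
  | step F B h hB ih =>
    obtain ⟨F', L, hG, h1, h2, h3⟩ := ih
    rcases B.eq_empty_or_nonempty with rfl | hne
    · refine ⟨F', L, hG, ?_, ?_, by simp [h3]⟩
      · rintro C (rfl | hC) hCn
        · exact absurd hCn (by simp)
        · exact h1 C hC hCn
      · intro C hC
        exact (h2 C hC).imp_left (Set.mem_insert_of_mem _)
    by_cases hA : (B ∩ ⋃₀ F).Nonempty
    · rcases hB with hB | ⟨P, hP, hB⟩
      · rw [hB] at hA; exact absurd hA (by simp)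
      have hP' : P ∈ F' := h1 P hP (hA.mono hB)
      rw [← h3] at hA hB
      obtain ⟨L', hG'⟩ := hG.attach' B P hP' hB hA
      refine ⟨_, L', hG', ?_, ?_, by simp [h3]⟩
      · rintro C (rfl | hC) hCn
        · exact Set.mem_insert _ _
        · exact Set.mem_insert_of_mem _ (h1 C hC hCn)
      · rintro C (rfl | hC)
        · exact Or.inl (Set.mem_insert _ _)
        · exact (h2 C hC).imp_left (Set.mem_insert_of_mem _)
    · obtain ⟨r, hr⟩ := hne
      rw [Set.not_nonempty_iff_eq_empty] at hA
      have hrU : r ∉ ⋃₀ F' := by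
        rw [h3]; intro hrU
        have : r ∈ B ∩ ⋃₀ F := ⟨hr, hrU⟩
        rw [hA] at this; exact this
      have hG1 := hG.single r hrU
      have hint : B ∩ ⋃₀ (insert {r} F') ⊆ {r} := by
        rintro x ⟨hx, C, rfl | hC, hxC⟩
        · exact hxC
        · have : x ∈ B ∩ ⋃₀ F := ⟨hx, by rw [← h3]; exact ⟨C, hC, hxC⟩⟩
          rw [hA] at this; exact absurd this (by simp)
      obtain ⟨L', hG'⟩ := hG1.attach' B {r} (Set.mem_insert _ _) hint
        ⟨r, hr, {r}, Set.mem_insert _ _, rfl⟩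
      refine ⟨_, L', hG', ?_, ?_, ?_⟩
      · rintro C (rfl | hC) hCn
        · exact Set.mem_insert _ _
        · exact Set.mem_insert_of_mem _ (Set.mem_insert_of_mem _ (h1 C hC hCn))
      · rintro C (rfl | rfl | hC)
        · exact Or.inl (Set.mem_insert _ _)
        · exact Or.inr ⟨r, rfl⟩
        · exact (h2 C hC).imp_left (Set.mem_insert_of_mem _)
      · rw [Set.sUnion_insert, Set.sUnion_insert, Set.sUnion_insert, h3, ← Set.union_assoc]
        congr 1
        exact Set.union_eq_left.2 (by simpa using hr)

theorem rip_singletons {V : Type} {F : Set (Set V)} (h : RIP F) (l : List V) :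
    ∃ F', RIP F' ∧ F ⊆ F' ∧ (∀ B ∈ F', B ∈ F ∨ ∃ v, B = {v}) ∧ ∀ v ∈ l, {v} ∈ F' := by
  induction l with
  | nil => exact ⟨F, h, subset_rfl, fun B hB => Or.inl hB, by simp⟩
  | cons v l ih =>
    obtain ⟨F', h1, h2, h3, h4⟩ := ih
    refine ⟨insert {v} F', RIP.step _ _ h1 ?_, h2.trans (Set.subset_insert _ _), ?_, ?_⟩
    · by_cases hv : v ∈ ⋃₀ F'
      · obtain ⟨P, hP, hvP⟩ := hv
        refine Or.inr ⟨P, hP, ?_⟩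
        rintro x ⟨rfl, _⟩
        exact hvP
      · left
        ext x
        simp only [Set.mem_empty_iff_false, iff_false]
        rintro ⟨rfl, hx⟩
        exact hv hx
    · rintro B (rfl | hB)
      · exact Or.inr ⟨v, rfl⟩
      · exact h3 B hB
    · intro w hw
      rcases List.mem_cons.1 hw with rfl | hw
      · exact Set.mem_insert _ _
      · exact Set.mem_insert_of_mem _ (h4 w hw)

/-- The graph in which two distinct vertices are adjacent iff they share a member. -/
def shareGraph {V : Type} (F : Set (Set V)) : SimpleGraph V where
  Adj u v := u ≠ v ∧ Share F u v
  symm := ⟨fun _ _ h => ⟨h.1.symm, h.2.imp fun _ hB => ⟨hB.1, hB.2.2, hB.2.1⟩⟩⟩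
  loopless := ⟨fun _ h => h.1 rfl⟩

theorem exists_top {V : Type} (L : V → ℕ) {B : Set V} (hB : B.Nonempty) :
    ∃ u ∈ B, u ∉ bot L B := by
  obtain ⟨a, ha, h⟩ := exists_min L B hB
  refine ⟨a, ha, ?_⟩
  rintro ⟨_, u, hu, hlt⟩
  exact absurd (h u hu) (not_le.2 hlt)

theorem bot_ncard {V : Type} [Finite V] (L : V → ℕ) {B : Set V} {k : ℕ} (hk : 1 ≤ k)
    (hB : B.ncard ≤ k + 1) : (bot L B).ncard ≤ k := by
  rcases B.eq_empty_or_nonempty with rfl | hne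
  · have : bot L (∅ : Set V) = ∅ := Set.subset_empty_iff.1 (bot_subset L ∅)
    rw [this]; simp
  · obtain ⟨u, hu, hu'⟩ := exists_top L hne
    have : (bot L B).ncard < B.ncard :=
      Set.ncard_lt_ncard ⟨bot_subset L B, fun h => hu' (h hu)⟩ (Set.toFinite _)
    omega

theorem three_le {V : Type} [Finite V] {S : Set V} (hS : S.ncard ≤ 2) {a b c : V} (ha : a ∈ S)
    (hb : b ∈ S) (hc : c ∈ S) : a = b ∨ a = c ∨ b = c := by
  by_contra hne
  push Not at hne
  have h3 : ({a, b, c} : Set V).ncard = 3 := Set.ncard_eq_three.2 ⟨a, b, c, hne.1, hne.2.1, hne.2.2, rfl⟩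
  have : ({a, b, c} : Set V).ncard ≤ S.ncard := by
    apply Set.ncard_le_ncard _ (Set.toFinite _)
    rintro x (rfl | rfl | rfl) <;> assumption
  omega

/-- At most two bottoms properly contain a given `(k-1)`-set. -/
theorem bots_simple {V : Type} [Finite V] {F : Set (Set V)} {L : V → ℕ} {k : ℕ} (hk : 3 ≤ k)
    (hG : Good F L) (hw : ∀ B ∈ F, B.ncard ≤ k + 1)
    (hs : ∀ X : Set V, X.ncard = k → ∀ B₁ ∈ F, ∀ B₂ ∈ F, ∀ B₃ ∈ F, X ⊆ B₁ → X ⊆ B₂ → X ⊆ B₃ →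
      B₁ = B₂ ∨ B₁ = B₃ ∨ B₂ = B₃)
    (X : Set V) (hX : X.ncard = k - 1) (B₁ B₂ B₃ : Set V) (h1 : B₁ ∈ F) (h2 : B₂ ∈ F) (h3 : B₃ ∈ F)
    (x1 : X ⊂ bot L B₁) (x2 : X ⊂ bot L B₂) (x3 : X ⊂ bot L B₃) :
    B₁ = B₂ ∨ B₁ = B₃ ∨ B₂ = B₃ := by
  have hXne : X.Nonempty := by
    rw [← Set.ncard_pos (Set.toFinite _)]; omega
  obtain ⟨C, hC, hXC, hfirst⟩ := hG.first X hXne ⟨B₁, h1, x1.1⟩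
  have tops : ∀ B ∈ F, X ⊂ bot L B → ∃ u, B \ bot L B = {u} ∧ u ∈ C \ bot L C ∧ u ∈ B ∧ u ∉ X := by
    intro B hB hXB
    have e1 := Set.ncard_lt_ncard hXB (Set.toFinite _)
    have e2 := hw B hB
    have e3 := Set.ncard_sdiff (bot_subset L B) (Set.toFinite _)
    have hne : B.Nonempty := by
      obtain ⟨x, hx⟩ := hXne
      exact ⟨x, (hXB.1 hx).1⟩
    obtain ⟨u, hu, hu'⟩ := exists_top L hne
    have e4 : (B \ bot L B).ncard ≤ 1 := by omega
    refine ⟨u, ?_, hfirst B hB hXB.1 ⟨hu, hu'⟩, hu, fun h => hu' (hXB.1 h)⟩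
    rw [Set.ncard_le_one (Set.toFinite _)] at e4
    ext x
    refine ⟨fun hx => e4 x hx u ⟨hu, hu'⟩, ?_⟩
    rintro rfl
    exact ⟨hu, hu'⟩
  obtain ⟨u1, t1, c1, b1, n1⟩ := tops B₁ h1 x1
  obtain ⟨u2, t2, c2, b2, n2⟩ := tops B₂ h2 x2
  obtain ⟨u3, t3, c3, b3, n3⟩ := tops B₃ h3 x3
  have ins : ∀ u, u ∉ X → (insert u X).ncard = k := by
    intro u hu
    rw [Set.ncard_insert_of_notMem hu (Set.toFinite _)]; omega
  have sub : ∀ u B, u ∈ B → X ⊂ bot L B → insert u X ⊆ B := by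
    intro u B hu hXB
    exact Set.insert_subset hu (hXB.1.trans (bot_subset L B))
  have subC : ∀ u, u ∈ C \ bot L C → insert u X ⊆ C := fun u hu =>
    Set.insert_subset hu.1 (hXC.trans (bot_subset L C))
  have allEq : u1 = u2 → u1 = u3 → B₁ = B₂ ∨ B₁ = B₃ ∨ B₂ = B₃ := by
    rintro rfl rfl
    exact hs _ (ins u1 n1) B₁ h1 B₂ h2 B₃ h3 (sub _ _ b1 x1) (sub _ _ b2 x2) (sub _ _ b3 x3)
  by_cases e1 : B₁ = C
  · subst e1
    rw [t1] at c2 c3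
    exact allEq c2.symm c3.symm
  by_cases e2 : B₂ = C
  · subst e2
    rw [t2] at c1 c3
    have c1' : u1 = u2 := c1
    have c3' : u3 = u2 := c3
    exact allEq c1' (c1'.trans c3'.symm)
  by_cases e3 : B₃ = C
  · subst e3
    rw [t3] at c1 c2
    have c1' : u1 = u3 := c1
    have c2' : u2 = u3 := c2
    exact allEq (c1'.trans c2'.symm) c1'
  have hCX : (C \ X).ncard ≤ 2 := by
    have := Set.ncard_sdiff (hXC.trans (bot_subset L C)) (Set.toFinite _)
    have := hw C hC
    omega
  rcases three_le hCX ⟨c1.1, n1⟩ ⟨c2.1, n2⟩ ⟨c3.1, n3⟩ with e | e | e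
  · subst e
    rcases hs _ (ins u1 n1) B₁ h1 B₂ h2 C hC (sub _ _ b1 x1) (sub _ _ b2 x2) (subC _ c1) with h | h | h
    · exact Or.inl h
    · exact absurd h e1
    · exact absurd h e2
  · subst e
    rcases hs _ (ins u1 n1) B₁ h1 B₃ h3 C hC (sub _ _ b1 x1) (sub _ _ b3 x3) (subC _ c1) with h | h | h
    · exact Or.inr (Or.inl h)
    · exact absurd h e1
    · exact absurd h e3
  · subst e
    rcases hs _ (ins u2 n2) B₂ h2 B₃ h3 C hC (sub _ _ b2 x2) (sub _ _ b3 x3) (subC _ c2) with h | h | h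
    · exact Or.inr (Or.inr h)
    · exact absurd h e2
    · exact absurd h e3

theorem bots_stw {V : Type} [Fintype V] [Nonempty V] {F : Set (Set V)} {L : V → ℕ} {k : ℕ}
    (hk : 3 ≤ k) (hG : Good F L) (hw : ∀ B ∈ F, B.ncard ≤ k + 1)
    (hs : ∀ X : Set V, X.ncard = k → ∀ B₁ ∈ F, ∀ B₂ ∈ F, ∀ B₃ ∈ F, X ⊆ B₁ → X ⊆ B₂ → X ⊆ B₃ →
      B₁ = B₂ ∨ B₁ = B₃ ∨ B₂ = B₃) :
    HasSimpleTreewidthLE (shareGraph (bot L '' F)) (k - 1) := by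
  obtain ⟨F', r1, r2, r3, r4⟩ := rip_singletons hG.rip (Finset.univ : Finset V).toList
  have r5 : ∀ v : V, {v} ∈ F' := fun v => r4 v (by simp)
  obtain ⟨v0⟩ := ‹Nonempty V›
  obtain ⟨ι, T, bag, i1, i2, i3, i4, i5, i6, i7⟩ := rip_to_tree r1 ⟨_, r5 v0⟩
  have hconn : T.Connected := by
    have := i1
    exact ⟨preconnected_of_conn_univ i2⟩
  refine ⟨⟨ι, T, hconn, i3, bag, ?_, ?_, fun v => preconnected_of_conn (i7 v)⟩, ?_, ?_⟩
  · intro v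
    obtain ⟨t, ht⟩ := i5 _ (r5 v)
    exact ⟨t, ht rfl⟩
  · rintro u v ⟨-, B, hB, hu, hv⟩
    obtain ⟨t, ht⟩ := i5 _ (r2 hB)
    exact ⟨t, ht hu, ht hv⟩
  · intro t
    show (bag t).ncard ≤ _
    rcases r3 _ (i4 t) with ⟨B, hB, hBt⟩ | ⟨v, hv⟩
    · rw [← hBt]
      have := bot_ncard L (by omega : 1 ≤ k) (hw B hB)
      omega
    · rw [hv, Set.ncard_singleton]; omega
  · intro X hX t₁ t₂ t₃ h1 h2 h3
    change X ⊆ bag t₁ at h1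
    change X ⊆ bag t₂ at h2
    change X ⊆ bag t₃ at h3
    by_contra hne
    push Not at hne
    obtain ⟨n12, n13, n23⟩ := hne
    have key : ∀ t t' : ι, t ≠ t' → X ⊆ bag t → X ⊆ bag t' →
        ∃ B ∈ F, bot L B = bag t ∧ X ⊂ bot L B := by
      intro t t' hne h h'
      have hss : X ⊂ bag t := by
        refine ⟨h, fun hle => hne (i6 _ _ (hle.trans h'))⟩
      rcases r3 _ (i4 t) with ⟨B, hB, hBt⟩ | ⟨v, hv⟩
      · exact ⟨B, hB, hBt, hBt ▸ hss⟩
      · exfalso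
        have := Set.ncard_lt_ncard hss (Set.toFinite _)
        rw [hv, Set.ncard_singleton] at this
        omega
    obtain ⟨B₁, f1, g1, s1⟩ := key t₁ t₂ n12 h1 h2
    obtain ⟨B₂, f2, g2, s2⟩ := key t₂ t₁ n12.symm h2 h1
    obtain ⟨B₃, f3, g3, s3⟩ := key t₃ t₁ n13.symm h3 h1
    rcases bots_simple hk hG hw hs X hX B₁ B₂ B₃ f1 f2 f3 s1 s2 s3 with e | e | e
    · exact n12 (i6 _ _ (by rw [← g1, ← g2, e]))
    · exact n13 (i6 _ _ (by rw [← g1, ← g3, e]))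
    · exact n23 (i6 _ _ (by rw [← g2, ← g3, e]))

theorem color_step {V : Type} [Finite V] {G : SimpleGraph V} {F : Set (Set V)} {L : V → ℕ}
    {p c : ℕ} (hG : Good F L) (hcov : ∀ v, v ∈ ⋃₀ F) (hadj : ∀ u v, G.Adj u v → Share F u v)
    (ψ : V → Fin c) (hψ : IsPCentered (shareGraph (bot L '' F)) p ψ) :
    IsPCentered G p (fun v => finProdFinEquiv
      ((⟨L v % (p + 1), Nat.mod_lt _ (Nat.succ_pos p)⟩ : Fin (p + 1)), ψ v)) := by
  intro H hH
  set S := H.verts with hS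
  set φ : V → Fin ((p + 1) * c) := fun v => finProdFinEquiv
      ((⟨L v % (p + 1), Nat.mod_lt _ (Nat.succ_pos p)⟩ : Fin (p + 1)), ψ v) with hφ
  have hφeq : ∀ u v, φ u = φ v ↔ L u % (p + 1) = L v % (p + 1) ∧ ψ u = ψ v := by
    intro u v
    simp only [hφ, EmbeddingLike.apply_eq_iff_eq, Prod.mk.injEq, Fin.mk.injEq]
  have hcS : Conn (Share F) S := by
    intro f hf a ha b hb hfa
    obtain ⟨w⟩ := hH.preconnected.coe ⟨a, ha⟩ ⟨b, hb⟩
    have key : ∀ (x y : H.verts), H.coe.Walk x y → f x → f y := by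
      intro x y w
      induction w with
      | nil => exact id
      | cons h _ ih =>
        exact fun hx => ih (hf _ (Subtype.coe_prop _) _ (Subtype.coe_prop _)
          (hadj _ _ (H.adj_sub h)) hx)
    exact key _ _ w hfa
  obtain ⟨s0, hs0, hmin⟩ := exists_min L S hH.nonempty
  by_cases hbig : ∃ s ∈ S, L s0 + p ≤ L s
  · left
    obtain ⟨s, hs, hls⟩ := hbig
    have hlev : ∀ j, j ≤ p → ∃ v ∈ S, L v = L s0 + j := by
      intro j hj
      by_contra hno
      push Not at hno
      have := hcS (fun v => L v < L s0 + j) ?_ s0 hs0 s hs ?_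
      · omega
      · rintro x hx y hy ⟨B, hB, hxB, hyB⟩ hlt
        have e1 := hG.lay B hB x hxB y hyB
        have e2 := hno y hy
        omega
      · have := hno s0 hs0
        omega
    have hlev' : ∀ j : Fin (p + 1), ∃ v ∈ S, L v = L s0 + j := fun j => hlev j (by omega)
    choose g hg1 hg2 using hlev'
    have hinj : Function.Injective (fun j => φ (g j)) := by
      intro j j' h
      have := ((hφeq _ _).1 h).1
      rw [hg2, hg2] at this
      have h' : (j : ℕ) ≡ j' [MOD p + 1] := Nat.ModEq.add_left_cancel' _ this
      apply Fin.ext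
      exact Nat.ModEq.eq_of_lt_of_lt h' j.2 j'.2
    have hsub : Set.range (fun j => φ (g j)) ⊆ φ '' S := by
      rintro _ ⟨j, rfl⟩
      exact ⟨g j, hg1 j, rfl⟩
    have e1 := Set.ncard_le_ncard hsub (Set.toFinite _)
    rw [← Set.image_univ, Set.ncard_image_of_injective _ hinj, Set.ncard_univ, Nat.card_eq_fintype_card,
      Fintype.card_fin] at e1
    omega
  push Not at hbig
  set S' := S ∩ {v | L v = L s0} with hS'
  have hcS' : Conn (Share (bot L '' F)) S' := hG.conn S (fun v _ => hcov v) hcS (L s0) hmin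
  have hcG : Conn (shareGraph (bot L '' F)).Adj S' := by
    intro f hf
    refine hcS' f ?_
    intro a ha b hb hab hfa
    by_cases h : a = b
    · rwa [← h]
    · exact hf a ha b hb ⟨h, hab⟩ hfa
  have hsc : ((⊤ : (shareGraph (bot L '' F)).Subgraph).induce S').Connected := by
    rw [← SimpleGraph.connected_induce_iff]
    have : Nonempty S' := ⟨⟨s0, hs0, rfl⟩⟩
    exact ⟨preconnected_of_conn hcG⟩
  have hv : ((⊤ : (shareGraph (bot L '' F)).Subgraph).induce S').verts = S' := rfl
  rcases hψ _ hsc with h | ⟨d, hd⟩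
  · left
    rw [hv] at h
    refine h.trans_le ?_
    have : ψ '' S' = (fun x => (finProdFinEquiv.symm x).2) '' (φ '' S') := by
      rw [Set.image_image]
      simp [hφ]
    rw [this]
    refine (Set.ncard_image_le (Set.toFinite _)).trans ?_
    exact Set.ncard_le_ncard (Set.image_mono Set.inter_subset_left) (Set.toFinite _)
  · right
    rw [hv] at hd
    obtain ⟨x, hx⟩ := Set.ncard_eq_one.1 hd
    have hx' : x ∈ {v | v ∈ S' ∧ ψ v = d} := by rw [hx]; rfl
    obtain ⟨⟨hxS, hxL⟩, hxd⟩ := hx'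
    have hxL' : L x = L s0 := hxL
    refine ⟨φ x, ?_⟩
    rw [Set.ncard_eq_one]
    refine ⟨x, ?_⟩
    ext y
    constructor
    · rintro ⟨hy, hyx⟩
      obtain ⟨h1, h2⟩ := (hφeq _ _).1 hyx
      have l1 := hmin y hy
      have l2 := hbig y hy
      have hyL : L y = L s0 := by
        rw [hxL'] at h1
        obtain ⟨j, hj⟩ := Nat.exists_eq_add_of_le l1
        rw [hj] at h1
        have h' : j ≡ 0 [MOD p + 1] := Nat.ModEq.add_left_cancel' (L s0) h1
        have := Nat.ModEq.eq_of_lt_of_lt h' (by omega) (by omega)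
        omega
      rw [← hx]
      exact ⟨⟨hy, hyL⟩, h2.trans hxd⟩
    · rintro rfl
      exact ⟨hxS, rfl⟩

/-- If every graph of simple treewidth at most `k - 1` admits a `p`-centered coloring with
at most `c` colors, then (for `k ≥ 3`, `p ≥ 1`) every graph of simple treewidth at most `k`
admits a `p`-centered coloring with at most `(p+1)·c` colors. -/
theorem simpleTreewidth_step {p k c : ℕ} (hk : 3 ≤ k) (hp : 1 ≤ p)
    (hind : ∀ (W : Type) [Fintype W] (H : SimpleGraph W),
      HasSimpleTreewidthLE H (k - 1) → ∃ ψ : W → Fin c, IsPCentered H p ψ) :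
    ∀ (V : Type) [Fintype V] (G : SimpleGraph V),
      HasSimpleTreewidthLE G k → ∃ φ : V → Fin ((p + 1) * c), IsPCentered G p φ := by
  intro V _ G hst
  rcases isEmpty_or_nonempty V with hV | hV
  · refine ⟨fun v => hV.elim v, fun H hH => ?_⟩
    obtain ⟨v, -⟩ := hH.nonempty
    exact hV.elim v
  obtain ⟨D, hw, hs⟩ := hst
  obtain ⟨F0, r1, r2, r3, r4⟩ := exists_rip D
  obtain ⟨F, L, hG, g1, g2, g3⟩ := exists_good r1
  have hw' : ∀ B ∈ F, B.ncard ≤ k + 1 := by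
    intro B hB
    rcases g2 B hB with h | ⟨v, rfl⟩
    · obtain ⟨t, rfl⟩ := r2 h
      exact hw t
    · rw [Set.ncard_singleton]; omega
  have hs' : ∀ X : Set V, X.ncard = k → ∀ B₁ ∈ F, ∀ B₂ ∈ F, ∀ B₃ ∈ F, X ⊆ B₁ → X ⊆ B₂ → X ⊆ B₃ →
      B₁ = B₂ ∨ B₁ = B₃ ∨ B₂ = B₃ := by
    intro X hX B₁ h1 B₂ h2 B₃ h3 x1 x2 x3
    have key : ∀ B ∈ F, X ⊆ B → ∃ t, D.bag t = B := by
      intro B hB hXB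
      rcases g2 B hB with h | ⟨v, rfl⟩
      · exact r2 h
      · have := Set.ncard_le_ncard hXB (Set.toFinite _)
        rw [Set.ncard_singleton] at this
        omega
    obtain ⟨t₁, rfl⟩ := key _ h1 x1
    obtain ⟨t₂, rfl⟩ := key _ h2 x2
    obtain ⟨t₃, rfl⟩ := key _ h3 x3
    rcases hs X hX t₁ t₂ t₃ x1 x2 x3 with rfl | rfl | rfl
    · exact Or.inl rfl
    · exact Or.inr (Or.inl rfl)
    · exact Or.inr (Or.inr rfl)
  obtain ⟨ψ, hψ⟩ := hind V _ (bots_stw hk hG hw' hs')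
  refine ⟨_, color_step hG ?_ ?_ ψ hψ⟩
  · intro v
    rw [g3]
    obtain ⟨B, hB, hv⟩ := r3 v
    exact ⟨B, hB, hv⟩
  · intro u v huv
    obtain ⟨B, hB, hu, hv⟩ := r4 u v huv
    exact ⟨B, g1 B hB ⟨u, hu⟩, hu, hv⟩
end

section
/- Let G be a connected graph of simple treewidth k ≥ 1 and let (V_0, V_1, …) be a BFS-layering of G. Then the induced subgraph G[V_i] has simple treewidth at most k−1 for every i ≥ 0. -/
open Classical in
theorem st_three_finite {α : Type} {s : Set α}
    (h : ∀ a ∈ s, ∀ b ∈ s, ∀ c ∈ s, a = b ∨ a = c ∨ b = c) : s.Finite := by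
  by_contra hinf
  obtain ⟨t, hts, htc⟩ := (show s.Infinite from hinf).exists_subset_card_eq 3
  obtain ⟨a, b, c, hab, hac, hbc, rfl⟩ := Finset.card_eq_three.1 htc
  have := h a (hts (by simp)) b (hts (by simp)) c (hts (by simp))
  tauto

/-- Rooted tree data. -/
structure RTree (ι : Type) where
  root : ι
  p : ι → ι
  d : ι → ℕ
  hd : ∀ x, x ≠ root → d (p x) < d x
  hroot : p root = root

namespace RTree
variable {ι : Type} (R : RTree ι)

def Sub (A : Set ι) : Prop := ∃ z ∈ A, ∀ x ∈ A, x ≠ z → x ≠ R.root ∧ R.p x ∈ A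

theorem d_le (x : ι) : R.d (R.p x) ≤ R.d x := by
  by_cases h : x = R.root
  · subst h; rw [R.hroot]
  · exact (R.hd x h).le

theorem d_iter (n : ℕ) (x : ι) : R.d (R.p^[n] x) ≤ R.d x := by
  induction n generalizing x with
  | zero => simp
  | succ n ih => rw [Function.iterate_succ_apply]; exact (ih _).trans (R.d_le x)

theorem eq_of_iter {n : ℕ} {x z : ι} (h : R.p^[n] z = x) (hd : R.d z ≤ R.d x) : z = x := by
  cases n with
  | zero => simpa using h
  | succ n =>
    by_cases hz : z = R.root
    · subst hz
      rw [← h]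
      exact (Function.iterate_fixed R.hroot (n+1)).symm
    · rw [Function.iterate_succ_apply] at h
      have := R.d_iter n (R.p z)
      rw [h] at this
      have := R.hd z hz
      omega

theorem desc {r : ι → ι → Prop}
    (hr : ∀ a b, r a b → (R.p a = b) ∨ (R.p b = a)) {x z : ι}
    (hx : ¬ r x (R.p x)) (h : Relation.ReflTransGen r x z) : ∃ n, R.p^[n] z = x := by
  induction h with
  | refl => exact ⟨0, rfl⟩
  | tail _ hbc ih =>
    rename_i b c _
    obtain ⟨n, hn⟩ := ih
    rcases hr _ _ hbc with h | h
    · cases n with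
      | zero =>
        simp only [Function.iterate_zero, id] at hn
        subst hn; subst h; exact absurd hbc hx
      | succ n => exact ⟨n, by rw [← h, ← hn]; rfl⟩
    · exact ⟨n+1, by rw [Function.iterate_succ_apply, h, hn]⟩

theorem rel_parent {r : ι → ι → Prop}
    (hr : ∀ a b, r a b → (R.p a = b) ∨ (R.p b = a)) {x : ι} (hx : x ≠ R.root)
    (h : Relation.ReflTransGen r x (R.p x)) : r x (R.p x) := by
  by_contra hc
  obtain ⟨n, hn⟩ := R.desc hr hc h
  have h1 := R.d_iter n (R.p x)
  rw [hn] at h1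
  have := R.hd x hx
  omega

theorem sub_of_conn {A : Set ι} (hA : A.Nonempty) {r : ι → ι → Prop}
    (hr : ∀ a b, r a b → (R.p a = b) ∨ (R.p b = a))
    (hrA : ∀ a b, r a b → a ∈ A ∧ b ∈ A)
    (hmin : ∀ x, x ≠ R.root → R.d R.root < R.d x)
    (h : ∀ x ∈ A, ∀ y ∈ A, Relation.ReflTransGen r x y) : R.Sub A := by
  obtain ⟨z, hz, hzm⟩ := exists_minimalFor_of_wellFoundedLT (· ∈ A) R.d hA
  refine ⟨z, hz, fun x hx hxz => ?_⟩
  have hle : R.d z ≤ R.d x := by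
    rcases le_total (R.d z) (R.d x) with h | h
    · exact h
    · exact hzm hx h
  constructor
  · rintro rfl
    have := hmin z (Ne.symm hxz)
    omega
  · by_contra hp
    have hnr : ¬ r x (R.p x) := fun h => hp (hrA _ _ h).2
    obtain ⟨n, hn⟩ := R.desc hr hnr (h x hx z hz)
    exact hxz (R.eq_of_iter hn hle).symm

/-- The top of a subtree has least depth. -/
theorem top_le {A : Set ι} {z : ι} (hz : ∀ x ∈ A, x ≠ z → x ≠ R.root ∧ R.p x ∈ A) :
    ∀ n x, R.d x = n → x ∈ A → R.d z ≤ R.d x ∧ (R.d x = R.d z → x = z) := by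
  intro n
  induction n using Nat.strong_induction_on with
  | _ n ih =>
    intro x hn hx
    by_cases h : x = z
    · subst h; simp
    · obtain ⟨h1, h2⟩ := hz x hx h
      have h3 := R.hd x h1
      have := (ih _ (by omega) (R.p x) rfl h2).1
      constructor
      · omega
      · intro; omega

theorem top_mem {A B : Set ι} {a b : ι}
    (ha : ∀ x ∈ A, x ≠ a → x ≠ R.root ∧ R.p x ∈ A)
    (hb : ∀ x ∈ B, x ≠ b → x ≠ R.root ∧ R.p x ∈ B) :
    ∀ n x, R.d x = n → x ∈ A → x ∈ B → (a ∈ A ∧ a ∈ B) ∨ (b ∈ A ∧ b ∈ B) := by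
  intro n
  induction n using Nat.strong_induction_on with
  | _ n ih =>
    intro x hn hxA hxB
    by_cases h : x = a
    · subst h; exact Or.inl ⟨hxA, hxB⟩
    by_cases h' : x = b
    · subst h'; exact Or.inr ⟨hxA, hxB⟩
    obtain ⟨h1, h2⟩ := ha x hxA h
    have h3 := R.hd x h1
    exact ih _ (by omega) (R.p x) rfl h2 (hb x hxB h').2

theorem Sub.inter_aux {A B : Set ι} {a b : ι}
    (ha : ∀ x ∈ A, x ≠ a → x ≠ R.root ∧ R.p x ∈ A)
    (hb : ∀ x ∈ B, x ≠ b → x ≠ R.root ∧ R.p x ∈ B) (h1 : a ∈ A) (h2 : a ∈ B) :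
    R.Sub (A ∩ B) := by
  refine ⟨a, ⟨h1, h2⟩, fun x hx hxa => ?_⟩
  obtain ⟨h3, h4⟩ := ha x hx.1 hxa
  refine ⟨h3, h4, (hb x hx.2 ?_).2⟩
  rintro rfl
  have e1 := R.top_le ha _ _ rfl hx.1
  have e2 := R.top_le hb _ _ rfl h2
  exact hxa (e1.2 (by omega))

theorem Sub.inter {A B : Set ι} (hA : R.Sub A) (hB : R.Sub B) (h : (A ∩ B).Nonempty) :
    R.Sub (A ∩ B) := by
  obtain ⟨a, ha0, ha⟩ := hA
  obtain ⟨b, hb0, hb⟩ := hB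
  obtain ⟨x, hx⟩ := h
  rcases R.top_mem ha hb _ x rfl hx.1 hx.2 with h | h
  · exact Sub.inter_aux R ha hb h.1 h.2
  · rw [Set.inter_comm]
    exact Sub.inter_aux R hb ha h.2 h.1

theorem Sub.helly {A B C : Set ι} (hA : R.Sub A) (hB : R.Sub B) (hC : R.Sub C)
    (h1 : (A ∩ B).Nonempty) (h2 : (B ∩ C).Nonempty) (h3 : (A ∩ C).Nonempty) :
    (A ∩ B ∩ C).Nonempty := by
  obtain ⟨a, ha0, ha⟩ := hA
  obtain ⟨b, hb0, hb⟩ := hB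
  obtain ⟨c, hc0, hc⟩ := hC
  obtain ⟨x, hx⟩ := h1
  obtain ⟨y, hy⟩ := h2
  obtain ⟨w, hw⟩ := h3
  have t1 := R.top_mem ha hb _ x rfl hx.1 hx.2
  have t2 := R.top_mem hb hc _ y rfl hy.1 hy.2
  have t3 := R.top_mem ha hc _ w rfl hw.1 hw.2
  rcases t1 with t1 | t1 <;> rcases t2 with t2 | t2 <;> rcases t3 with t3 | t3
  · exact ⟨a, ⟨t1.1, t1.2⟩, t3.2⟩
  · have e1 := R.top_le hb _ _ rfl t1.2
    have e2 := R.top_le hc _ _ rfl t2.2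
    have e3 := R.top_le ha _ _ rfl t3.1
    have : a = b := e1.2 (by omega)
    subst this
    exact ⟨a, ⟨t1.1, t1.2⟩, t2.2⟩
  · exact ⟨a, ⟨t1.1, t1.2⟩, t3.2⟩
  · exact ⟨c, ⟨t3.1, t2.1⟩, t3.2⟩
  · exact ⟨b, ⟨t1.1, t1.2⟩, t2.2⟩
  · exact ⟨b, ⟨t1.1, t1.2⟩, t2.2⟩
  · have e1 := R.top_le ha _ _ rfl t1.1
    have e2 := R.top_le hb _ _ rfl t2.1
    have e3 := R.top_le hc _ _ rfl t3.2
    have : b = a := e1.2 (by omega)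
    subst this
    exact ⟨b, ⟨t1.1, t1.2⟩, t3.2⟩
  · exact ⟨c, ⟨t3.1, t2.1⟩, t3.2⟩

theorem sub_univ : R.Sub Set.univ :=
  ⟨R.root, trivial, fun _ _ h => ⟨h, trivial⟩⟩

open Classical in
theorem sub_bags {W : Type} (B : ι → Finset W) (hsub : ∀ v, R.Sub {t | v ∈ B t})
    (X : Finset W) (h : {t | X ⊆ B t}.Nonempty) : R.Sub {t | X ⊆ B t} := by
  induction X using Finset.induction_on with
  | empty => simpa using R.sub_univ
  | insert a s _ ih =>
    have e : {t | insert a s ⊆ B t} = {t | a ∈ B t} ∩ {t | s ⊆ B t} := by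
      ext t; simp [Finset.insert_subset_iff]
    rw [e] at h ⊢
    exact Sub.inter R (hsub a) (ih (h.mono Set.inter_subset_right)) h

/-- A child of the top inside a subtree with another element. -/
theorem exists_child {A : Set ι} {z : ι} (hz : ∀ x ∈ A, x ≠ z → x ≠ R.root ∧ R.p x ∈ A) :
    ∀ n x, R.d x = n → x ∈ A → x ≠ z → ∃ c ∈ A, c ≠ R.root ∧ R.p c = z := by
  intro n
  induction n using Nat.strong_induction_on with
  | _ n ih =>
    intro x hn hx hxz
    obtain ⟨h1, h2⟩ := hz x hx hxz
    by_cases h : R.p x = z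
    · exact ⟨x, hx, h1, h⟩
    · have := R.hd x h1
      exact ih _ (by omega) _ rfl h2 h

/-- The tree as a graph. -/
def graph : SimpleGraph ι where
  Adj x y := (x ≠ R.root ∧ R.p x = y) ∨ (y ≠ R.root ∧ R.p y = x)
  symm := ⟨fun _ _ h => h.symm⟩
  loopless := ⟨fun x h => by
    rcases h with h | h <;>
    · have := R.hd x h.1
      rw [h.2] at this
      omega⟩

theorem sub_preconn {A : Set ι} (hA : R.Sub A) : (R.graph.induce A).Preconnected := by
  obtain ⟨z, hzA, hz⟩ := hA
  have key : ∀ n x, R.d x = n → ∀ hx : x ∈ A,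
      (R.graph.induce A).Reachable ⟨x, hx⟩ ⟨z, hzA⟩ := by
    intro n
    induction n using Nat.strong_induction_on with
    | _ n ih =>
      intro x hn hx
      by_cases h : x = z
      · subst h; exact SimpleGraph.Reachable.refl _
      · obtain ⟨h1, h2⟩ := hz x hx h
        have := R.hd x h1
        have hadj : (R.graph.induce A).Adj ⟨x, hx⟩ ⟨R.p x, h2⟩ := by
          simp only [SimpleGraph.comap_adj]
          exact Or.inl ⟨h1, rfl⟩
        exact hadj.reachable.trans (ih _ (by omega) _ rfl h2)
  rintro ⟨x, hx⟩ ⟨y, hy⟩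
  exact (key _ x rfl hx).trans (key _ y rfl hy).symm

theorem graph_connected : R.graph.Connected := by
  have h := R.sub_preconn R.sub_univ
  have : Nonempty ι := ⟨R.root⟩
  refine SimpleGraph.Connected.mk ?_
  intro x y
  have := (h ⟨x, trivial⟩ ⟨y, trivial⟩).map (SimpleGraph.Embedding.induce Set.univ).toHom
  simpa using this

theorem graph_acyclic : R.graph.IsAcyclic := by
  rw [SimpleGraph.isAcyclic_iff_forall_adj_isBridge]
  have key : ∀ x, x ≠ R.root → R.graph.IsBridge s(x, R.p x) := by
    intro x hx
    rw [SimpleGraph.isBridge_iff]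
    intro hreach
    rw [SimpleGraph.reachable_iff_reflTransGen] at hreach
    have := R.rel_parent (r := (R.graph.deleteEdges {s(x, R.p x)}).Adj) ?_ hx hreach
    · simp at this
    · intro a b hab
      have : R.graph.Adj a b := by
        simp only [SimpleGraph.deleteEdges_adj] at hab
        exact hab.1
      rcases this with h | h
      · exact Or.inl h.2
      · exact Or.inr h.2
  intro x y hxy
  rcases hxy with ⟨h, rfl⟩ | ⟨h, rfl⟩
  · exact key x h
  · rw [Sym2.eq_swap]; exact key y h

/-- Contract the node `c` into its parent. -/
noncomputable def contract (c : ι) (hc : c ≠ R.root) : RTree {x // x ≠ c} := by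
  classical
  have hpc : R.p c ≠ c := fun h => by
    have := R.hd c hc
    rw [h] at this; omega
  exact {
    root := ⟨R.root, hc.symm⟩
    p := fun x => if h : R.p x = c then ⟨R.p c, hpc⟩ else ⟨R.p x, h⟩
    d := fun x => R.d x
    hd := by
      rintro ⟨x, hx⟩ hxr
      have hxr' : x ≠ R.root := fun h => hxr (Subtype.ext h)
      have h1 := R.hd x hxr'
      dsimp only
      split_ifs with h
      · have := R.hd c hc
        rw [h] at h1
        dsimp only
        omega
      · exact h1
    hroot := by
      apply Subtype.ext
      dsimp only
      split_ifs with h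
      · rw [R.hroot] at h; exact absurd h.symm hc
      · exact R.hroot }

open Classical in
theorem contract_p (c : ι) (hc : c ≠ R.root) (x : {x // x ≠ c}) :
    ((R.contract c hc).p x : ι) = if R.p x = c then R.p c else R.p x := by
  simp only [contract]
  split_ifs <;> rfl

theorem contract_sub (c : ι) (hc : c ≠ R.root) {A : Set ι} (hA : R.Sub A)
    {A' : Set {x // x ≠ c}}
    (hA' : ∀ x : {x // x ≠ c}, x ∈ A' ↔ (x.1 ∈ A ∨ (x.1 = R.p c ∧ c ∈ A))) :
    (R.contract c hc).Sub A' := by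
  classical
  have hpc : R.p c ≠ c := fun h => by
    have := R.hd c hc
    rw [h] at this; omega
  obtain ⟨z, hzA, hz⟩ := hA
  have hpar : ∀ x : {x // x ≠ c}, R.p x ∈ A → (R.contract c hc).p x ∈ A' := by
    intro x hx
    rw [hA', contract_p]
    split_ifs with h
    · right; rw [h] at hx; exact ⟨rfl, hx⟩
    · left; exact hx
  have hfin : ∀ x : {x // x ≠ c}, x.1 ∈ A → x.1 ≠ z →
      x ≠ (R.contract c hc).root ∧ (R.contract c hc).p x ∈ A' := by
    intro x hx hxz
    obtain ⟨h1, h2⟩ := hz x hx hxz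
    exact ⟨fun h => h1 (congrArg Subtype.val h), hpar x h2⟩
  by_cases hzc : z = c
  · subst hzc
    refine ⟨⟨R.p z, hpc⟩, (hA' _).2 (Or.inr ⟨rfl, hzA⟩), fun x hx hxz => ?_⟩
    have hxz' : x.1 ≠ R.p z := fun h => hxz (Subtype.ext h)
    rcases (hA' x).1 hx with h | h
    · exact hfin x h x.2
    · exact absurd h.1 hxz'
  · refine ⟨⟨z, hzc⟩, (hA' _).2 (Or.inl hzA), fun x hx hxz => ?_⟩
    have hxz' : x.1 ≠ z := fun h => hxz (Subtype.ext h)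
    rcases (hA' x).1 hx with h | h
    · exact hfin x h hxz'
    · have := (hz c h.2 (Ne.symm hzc)).2
      rw [← h.1] at this
      exact hfin x this hxz'

/-- Restrict to a subtree. -/
noncomputable def restrict (A : Set ι) (z : ι) (hzA : z ∈ A)
    (hz : ∀ x ∈ A, x ≠ z → x ≠ R.root ∧ R.p x ∈ A) : RTree {x // x ∈ A} := by
  classical
  exact {
    root := ⟨z, hzA⟩
    p := fun x => if h : x.1 = z then x else ⟨R.p x, (hz x x.2 h).2⟩
    d := fun x => R.d x
    hd := by
      rintro ⟨x, hx⟩ hxr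
      have hxr' : x ≠ z := fun h => hxr (Subtype.ext h)
      simp only [hxr', dif_neg, not_false_eq_true]
      exact R.hd x (hz x hx hxr').1
    hroot := by simp }

theorem restrict_p (A : Set ι) (z : ι) (hzA : z ∈ A)
    (hz : ∀ x ∈ A, x ≠ z → x ≠ R.root ∧ R.p x ∈ A) (x : {x // x ∈ A}) (hx : x.1 ≠ z) :
    ((R.restrict A z hzA hz).p x : ι) = R.p x := by
  simp [restrict, hx]

theorem restrict_sub (A : Set ι) (z : ι) (hzA : z ∈ A)
    (hz : ∀ x ∈ A, x ≠ z → x ≠ R.root ∧ R.p x ∈ A) {C : Set ι} (hC : R.Sub C)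
    (hne : (C ∩ A).Nonempty) :
    (R.restrict A z hzA hz).Sub {x | x.1 ∈ C} := by
  obtain ⟨w, hw, hw'⟩ := Sub.inter R hC ⟨z, hzA, hz⟩ hne
  refine ⟨⟨w, hw.2⟩, hw.1, fun x hx hxw => ?_⟩
  have hxw' : x.1 ≠ w := fun h => hxw (Subtype.ext h)
  obtain ⟨h1, h2⟩ := hw' x.1 ⟨hx, x.2⟩ hxw'
  have hxz : x.1 ≠ z := by
    intro h
    have e1 := R.top_le hz _ _ rfl hw.2
    have e2 := R.top_le hw' _ _ rfl (⟨hx, x.2⟩ : x.1 ∈ C ∩ A)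
    rw [h] at e2
    exact hxw' (h.trans (e2.2 (by omega)))
  refine ⟨fun h => hxz (congrArg Subtype.val h), ?_⟩
  show ((R.restrict A z hzA hz).p x : ι) ∈ C
  rw [R.restrict_p A z hzA hz x hxz]
  exact h2.1

end RTree

/-- Existence of a rooting of a tree. -/
theorem exists_rooting {ι : Type} (T : SimpleGraph ι) (hc : T.Connected) (ha : T.IsAcyclic) :
    ∃ R : RTree ι, (∀ x, x ≠ R.root → R.d R.root < R.d x) ∧
      (∀ x, x ≠ R.root → T.Adj x (R.p x)) ∧
      ∀ x y, T.Adj x y → R.p x = y ∨ R.p y = x := by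
  classical
  obtain ⟨ρ⟩ := hc.nonempty
  have hex : ∀ x, x ≠ ρ → ∃ y, T.Adj x y ∧ T.dist ρ y < T.dist ρ x := by
    intro x hx
    obtain ⟨w, hw⟩ := hc.exists_walk_length_eq_dist x ρ
    cases w with
    | nil => exact absurd rfl hx
    | cons h q =>
      rename_i y
      refine ⟨y, h, ?_⟩
      have := SimpleGraph.dist_le q
      rw [SimpleGraph.Walk.length_cons] at hw
      rw [SimpleGraph.dist_comm, SimpleGraph.dist_comm (u := ρ) (v := x)]
      omega
  choose! f hf using hex
  let R : RTree ι :=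
    { root := ρ
      p := fun x => if x = ρ then ρ else f x
      d := fun x => T.dist ρ x
      hd := fun x hx => by simpa [hx] using (hf x hx).2
      hroot := by simp }
  have hp : ∀ x, x ≠ R.root → T.Adj x (R.p x) := by
    intro x hx
    have hx' : x ≠ ρ := hx
    simpa [R, hx'] using (hf x hx').1
  refine ⟨R, ?_, hp, ?_⟩
  · intro x hx
    have hx' : ρ ≠ x := Ne.symm hx
    simpa [R] using hc.pos_dist_of_ne hx'
  · intro x y hxy
    by_contra hcon
    push Not at hcon
    have hb := (SimpleGraph.isAcyclic_iff_forall_adj_isBridge.1 ha) hxy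
    rw [SimpleGraph.isBridge_iff] at hb
    apply hb
    refine (R.graph_connected.preconnected x y).mono ?_
    intro a b hab
    rw [SimpleGraph.deleteEdges_adj]
    refine ⟨?_, ?_⟩
    · rcases hab with ⟨h, rfl⟩ | ⟨h, rfl⟩
      · exact hp a h
      · exact (hp b h).symm
    · intro hmem
      simp only [Set.mem_singleton_iff, Sym2.eq_iff] at hmem
      rcases hab with ⟨h, h'⟩ | ⟨h, h'⟩ <;> rcases hmem with ⟨rfl, rfl⟩ | ⟨rfl, rfl⟩ <;> tauto

theorem reduce_aux {W : Type} (H : SimpleGraph W) (m : ℕ) :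
    ∀ (n : ℕ) (ι : Type) (R : RTree ι) (B : ι → Finset W)
      (_ : ∀ v, ∃ t, v ∈ B t) (_ : ∀ u v, H.Adj u v → ∃ t, u ∈ B t ∧ v ∈ B t)
      (_ : ∀ v, R.Sub {t | v ∈ B t}) (_ : ∀ t, (B t).card ≤ m + 1)
      (_ : ∀ X : Finset W, X.card = m → ∀ t₁ t₂ t₃, X ⊂ B t₁ → X ⊂ B t₂ → X ⊂ B t₃ →
        t₁ = t₂ ∨ t₁ = t₃ ∨ t₂ = t₃)
      (_ : {t | (B t).card = m}.Finite) (_ : {t | (B t).card = m}.ncard ≤ n),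
      HasSimpleTreewidthLE H m := by
  classical
  intro n
  induction n with
  | zero | succ n ih =>
    intro ι R B hv he hsub hcard hstrict hfin hn
    by_cases hred : ∃ c, c ≠ R.root ∧ (((B c).card = m ∧ B c ⊆ B (R.p c)) ∨
        ((B (R.p c)).card = m ∧ B (R.p c) ⊆ B c))
    ·
      obtain ⟨c, hc, hor⟩ := hred
      have hpc : R.p c ≠ c := fun h => by
        have := R.hd c hc
        rw [h] at this; omega
      first
      | (exfalso
         have h0 : {t | (B t).card = m} = ∅ := by
           rw [← Set.ncard_eq_zero hfin]; omega
         rcases hor with h | h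
         · have : c ∈ {t | (B t).card = m} := h.1
           rw [h0] at this; exact this
         · have : R.p c ∈ {t | (B t).card = m} := h.1
           rw [h0] at this; exact this)
      |
        obtain ⟨φ, e, hφ, he0, hne, hB⟩ : ∃ (φ : {x // x ≠ c} → ι) (e : ι), Function.Injective φ ∧
            (B e).card = m ∧ (∀ x, φ x ≠ e) ∧
            ∀ (x : {x // x ≠ c}) (v : W), v ∈ B (φ x) ↔ (v ∈ B x.1 ∨ (x.1 = R.p c ∧ v ∈ B c)) := by
          rcases hor with h | h
          · refine ⟨Subtype.val, c, Subtype.val_injective, h.1, fun x => x.2, fun x v => ?_⟩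
            constructor
            · exact Or.inl
            · rintro (h' | ⟨h', h''⟩)
              · exact h'
              · rw [h']; exact h.2 h''
          · refine ⟨fun x => if x.1 = R.p c then c else x.1, R.p c, ?_, h.1, ?_, ?_⟩
            · rintro ⟨x, hx⟩ ⟨y, hy⟩ hxy
              dsimp only at hxy
              apply Subtype.ext
              split_ifs at hxy with h1 h2 h2
              · exact h1.trans h2.symm
              · exact absurd hxy.symm hy
              · exact absurd hxy hx
              · exact hxy
            · rintro ⟨x, hx⟩
              dsimp only
              split_ifs with h1
              · exact hpc.symm
              · exact h1
            · rintro ⟨x, hx⟩ v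
              dsimp only
              split_ifs with h1
              · subst h1
                constructor
                · intro h'; exact Or.inr ⟨rfl, h'⟩
                · rintro (h' | h')
                  · exact h.2 h'
                  · exact h'.2
              · simp [h1]
        have hρ : ∀ t, ∃ x : {x // x ≠ c}, B t ⊆ B (φ x) := by
          intro t
          by_cases ht : t = c
          · subst ht
            exact ⟨⟨R.p t, hpc⟩, fun v hv' => (hB _ v).2 (Or.inr ⟨rfl, hv'⟩)⟩
          · exact ⟨⟨t, ht⟩, fun v hv' => (hB _ v).2 (Or.inl hv')⟩
        refine ih {x // x ≠ c} (R.contract c hc) (fun x => B (φ x)) ?_ ?_ ?_ ?_ ?_ ?_ ?_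
        · intro v
          obtain ⟨t, ht⟩ := hv v
          obtain ⟨x, hx⟩ := hρ t
          exact ⟨x, hx ht⟩
        · intro u v huv
          obtain ⟨t, ht⟩ := he u v huv
          obtain ⟨x, hx⟩ := hρ t
          exact ⟨x, hx ht.1, hx ht.2⟩
        · intro v
          exact R.contract_sub c hc (hsub v) (fun x => hB x v)
        · intro x; exact hcard _
        · intro X hX t₁ t₂ t₃ h1 h2 h3
          rcases hstrict X hX _ _ _ h1 h2 h3 with h | h | h
          · exact Or.inl (hφ h)
          · exact Or.inr (Or.inl (hφ h))
          · exact Or.inr (Or.inr (hφ h))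
        · exact hfin.preimage hφ.injOn
        · have h1 : (φ '' {t | (B (φ t)).card = m}) ⊆ {t | (B t).card = m} \ {e} := by
            rintro _ ⟨x, hx, rfl⟩
            exact ⟨hx, hne x⟩
          have h2 := Set.ncard_le_ncard h1 hfin.sdiff
          rw [Set.ncard_image_of_injective _ hφ] at h2
          have h3 := Set.ncard_sdiff_singleton_lt_of_mem (show e ∈ {t | (B t).card = m} from he0) hfin
          omega
    · push Not at hred
      refine ⟨⟨ι, R.graph, R.graph_connected, R.graph_acyclic, fun t => (B t : Set W), ?_, ?_, ?_⟩,
        ?_, ?_⟩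
      · intro v; obtain ⟨t, ht⟩ := hv v; exact ⟨t, by simpa using ht⟩
      · intro u v huv; obtain ⟨t, ht⟩ := he u v huv; exact ⟨t, by simpa using ht⟩
      · intro v
        exact R.sub_preconn (hsub v)
      · intro t
        show ((B t : Set W)).ncard ≤ m + 1
        rw [Set.ncard_coe_finset]; exact hcard t
      · intro X hX t₁ t₂ t₃ h1 h2 h3
        change ι at t₁ t₂ t₃
        change X ⊆ (B t₁ : Set W) at h1
        change X ⊆ (B t₂ : Set W) at h2
        change X ⊆ (B t₃ : Set W) at h3
        have hXf : X.Finite := (B t₁).finite_toSet.subset h1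
        lift X to Finset W using hXf
        rw [Set.ncard_coe_finset] at hX
        rw [Finset.coe_subset] at h1 h2 h3
        have hex : ∀ t t', X ⊆ B t → X ⊆ B t' → t' ≠ t → X ⊂ B t := by
          intro t t' ht ht' hne
          refine lt_of_le_of_ne ht ?_
          intro hXt
          obtain ⟨z, hzA, hz⟩ := R.sub_bags B hsub X ⟨t, ht⟩
          by_cases htz : t = z
          · subst htz
            obtain ⟨c, hcA, hcr, hcz⟩ := R.exists_child hz _ t' rfl ht' hne
            have := (hred c hcr).2
            rw [hcz, ← hXt] at this
            exact this hX hcA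
          · obtain ⟨h4, h5⟩ := hz t ht htz
            have := (hred t h4).1
            rw [← hXt] at this
            exact this hX h5
        by_cases e12 : t₁ = t₂
        · exact Or.inl e12
        by_cases e13 : t₁ = t₃
        · exact Or.inr (Or.inl e13)
        exact hstrict X hX t₁ t₂ t₃ (hex _ _ h1 h2 (Ne.symm e12)) (hex _ _ h2 h1 e12)
          (hex _ _ h3 h1 e13)

theorem exists_closer {V : Type} (G : SimpleGraph V) (hc : G.Connected) (ρ x : V) (hx : x ≠ ρ) :
    ∃ y, G.Adj x y ∧ G.dist ρ y < G.dist ρ x := by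
  obtain ⟨w, hw⟩ := hc.exists_walk_length_eq_dist x ρ
  cases w with
  | nil => exact absurd rfl hx
  | cons h q =>
    rename_i y
    refine ⟨y, h, ?_⟩
    have := SimpleGraph.dist_le q
    rw [SimpleGraph.Walk.length_cons] at hw
    rw [SimpleGraph.dist_comm, SimpleGraph.dist_comm (u := ρ) (v := x)]
    omega

theorem layer_pos {V : Type} [Fintype V] (G : SimpleGraph V)
    (hG : G.Connected) (m : ℕ) (h : HasSimpleTreewidthLE G (m + 1))
    (r : V) (i : ℕ) (hi : 0 < i) :
    HasSimpleTreewidthLE (G.induce {v | G.dist r v = i}) m := by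
  classical
  obtain ⟨D, hw, hs⟩ := h
  obtain ⟨R, hmin, -, hRadj⟩ := exists_rooting D.tree D.tree_connected D.tree_acyclic
  have hTv : ∀ v, R.Sub {t | v ∈ D.bag t} := by
    intro v
    refine R.sub_of_conn (r := fun a b => D.tree.Adj a b ∧ v ∈ D.bag a ∧ v ∈ D.bag b)
      (D.vert_cover v) (fun a b hab => hRadj a b hab.1) (fun a b hab => hab.2) hmin ?_
    intro x hx y hy
    have := D.bag_subtree v ⟨x, hx⟩ ⟨y, hy⟩
    rw [SimpleGraph.reachable_iff_reflTransGen] at this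
    refine Relation.ReflTransGen.lift Subtype.val ?_ _ _ this
    intro a b hab
    exact ⟨hab, a.2, b.2⟩
  let rel : D.ι → D.ι → Prop := fun a b =>
    D.tree.Adj a b ∧ ∃ s, G.dist r s < i ∧ s ∈ D.bag a ∧ s ∈ D.bag b
  have hrel : ∀ a b, rel a b → R.p a = b ∨ R.p b = a := fun a b hab => hRadj a b hab.1
  have hsymm : ∀ {a b}, Relation.ReflTransGen rel a b → Relation.ReflTransGen rel b a := by
    intro a b hab
    have hst : Std.Symm rel := ⟨by
      rintro a b ⟨h1, s, h2, h3, h4⟩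
      exact ⟨h1.symm, s, h2, h4, h3⟩⟩
    exact (Relation.ReflTransGen.stdSymm (r := rel)).symm _ _ hab
  have within : ∀ s, G.dist r s < i → ∀ t t', s ∈ D.bag t → s ∈ D.bag t' →
      Relation.ReflTransGen rel t t' := by
    intro s hsi t t' ht ht'
    have := D.bag_subtree s ⟨t, ht⟩ ⟨t', ht'⟩
    rw [SimpleGraph.reachable_iff_reflTransGen] at this
    refine Relation.ReflTransGen.lift Subtype.val ?_ _ _ this
    intro a b hab
    exact ⟨hab, s, hsi, a.2, b.2⟩
  obtain ⟨t0, ht0⟩ := D.vert_cover r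
  have key : ∀ n s, G.dist r s = n → n < i → ∀ t, s ∈ D.bag t →
      Relation.ReflTransGen rel t t0 := by
    intro n
    induction n using Nat.strong_induction_on with
    | _ n ih =>
      intro s hsn hni t ht
      by_cases hsr : s = r
      · subst hsr
        exact within s (by omega) t t0 ht ht0
      · obtain ⟨s', hadj, hlt⟩ := exists_closer G hG r s hsr
        obtain ⟨c, hc1, hc2⟩ := D.edge_cover hadj
        exact (within s (by omega) t c ht hc1).trans
          (ih _ (by omega) s' rfl (by omega) c hc2)
  let A : Set D.ι := {t | ∃ s, G.dist r s < i ∧ s ∈ D.bag t}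
  have hconn : ∀ x ∈ A, ∀ y ∈ A, Relation.ReflTransGen rel x y := by
    rintro x ⟨s, hs1, hs2⟩ y ⟨s', hs1', hs2'⟩
    exact (key _ s rfl hs1 x hs2).trans (hsymm (key _ s' rfl hs1' y hs2'))
  have hAsub : R.Sub A := by
    refine R.sub_of_conn (r := rel) ⟨t0, r, by simpa using hi, ht0⟩ hrel ?_ hmin hconn
    rintro a b ⟨-, s, h1, h2, h3⟩
    exact ⟨⟨s, h1, h2⟩, ⟨s, h1, h3⟩⟩
  have hlabel : ∀ t ∈ A, t ≠ R.root → R.p t ∈ A →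
      ∃ s, G.dist r s < i ∧ s ∈ D.bag t ∧ s ∈ D.bag (R.p t) := by
    intro t ht htr hpt
    exact (R.rel_parent hrel htr (hconn t ht _ hpt)).2
  let W := {v : V // v ∈ {v | G.dist r v = i}}
  let B : D.ι → Finset W := fun t => Finset.univ.filter (fun v => v.1 ∈ D.bag t)
  let L : D.ι → Finset V := fun t => Finset.univ.filter (fun s => G.dist r s < i ∧ s ∈ D.bag t)
  have hB : ∀ t v, v ∈ B t ↔ v.1 ∈ D.bag t := by intro t v; simp [B]
  have hL : ∀ t s, s ∈ L t ↔ G.dist r s < i ∧ s ∈ D.bag t := by intro t v; simp [L]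
  have hBL : ∀ t, (B t).card + (L t).card ≤ m + 2 := by
    intro t
    have h1 := hw t
    have h2 : Disjoint ((B t).map (Function.Embedding.subtype _)) (L t) := by
      rw [Finset.disjoint_left]
      intro v hv hv'
      rw [Finset.mem_map] at hv
      obtain ⟨w, hw1, rfl⟩ := hv
      have h3 := ((hL _ _).1 hv').1
      have h4 : G.dist r w.1 = i := w.2
      simp only [Function.Embedding.subtype_apply] at h3
      omega
    have h3 : (((B t).map (Function.Embedding.subtype _) ∪ L t : Finset V) : Set V) ⊆ D.bag t := by
      intro v hv
      rw [Finset.mem_coe, Finset.mem_union, Finset.mem_map] at hv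
      rcases hv with ⟨w, hw1, rfl⟩ | hv
      · exact (hB _ _).1 hw1
      · exact ((hL _ _).1 hv).2
    have h4 := Set.ncard_le_ncard h3 (Set.toFinite _)
    rw [Set.ncard_coe_finset, Finset.card_union_of_disjoint h2, Finset.card_map] at h4
    omega
  have hXs : ∀ (X : Finset W), X.card = m → ∀ s, G.dist r s < i → ∀ t₁ t₂ t₃,
      X ⊆ B t₁ → X ⊆ B t₂ → X ⊆ B t₃ → s ∈ D.bag t₁ → s ∈ D.bag t₂ → s ∈ D.bag t₃ →
      t₁ = t₂ ∨ t₁ = t₃ ∨ t₂ = t₃ := by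
    intro X hX s hsi t₁ t₂ t₃ h1 h2 h3 g1 g2 g3
    have hns : s ∉ X.map (Function.Embedding.subtype _) := by
      intro hv
      rw [Finset.mem_map] at hv
      obtain ⟨w, hw1, rfl⟩ := hv
      have h4 : G.dist r w.1 = i := w.2
      simp only [Function.Embedding.subtype_apply] at hsi
      omega
    have hsubs : ∀ t, X ⊆ B t → s ∈ D.bag t →
        ((insert s (X.map (Function.Embedding.subtype _)) : Finset V) : Set V) ⊆ D.bag t := by
      intro t ht hst v hv
      rw [Finset.mem_coe, Finset.mem_insert, Finset.mem_map] at hv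
      rcases hv with rfl | ⟨w, hw1, rfl⟩
      · exact hst
      · exact (hB _ _).1 (ht hw1)
    refine hs ((insert s (X.map (Function.Embedding.subtype _)) : Finset V) : Set V) ?_ t₁ t₂ t₃
      (hsubs _ h1 g1) (hsubs _ h2 g2) (hsubs _ h3 g3)
    rw [Set.ncard_coe_finset, Finset.card_insert_of_notMem hns, Finset.card_map, hX]
  have hQfin : ∀ X : Finset W, X.card = m → {t | t ∈ A ∧ X ⊆ B t}.Finite := by
    intro X hX
    have : {t | t ∈ A ∧ X ⊆ B t} ⊆
        ⋃ s : V, {t | G.dist r s < i ∧ s ∈ D.bag t ∧ X ⊆ B t} := by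
      rintro t ⟨⟨s, h1, h2⟩, h3⟩
      exact Set.mem_iUnion.2 ⟨s, h1, h2, h3⟩
    refine Set.Finite.subset (Set.finite_iUnion fun s => ?_) this
    apply st_three_finite
    intro a ha b hb c hc
    exact hXs X hX s ha.1 a b c ha.2.2 hb.2.2 hc.2.2 ha.2.1 hb.2.1 hc.2.1
  have hBsub : ∀ v : W, R.Sub {t | v ∈ B t} := by
    intro v
    have := hTv v.1
    simpa only [hB] using this
  have hstrict : ∀ X : Finset W, X.card = m → ∀ t₁ ∈ A, ∀ t₂ ∈ A, ∀ t₃ ∈ A,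
      X ⊂ B t₁ → X ⊂ B t₂ → X ⊂ B t₃ → t₁ = t₂ ∨ t₁ = t₃ ∨ t₂ = t₃ := by
    intro X hX t₁ a1 t₂ a2 t₃ a3 h1 h2 h3
    by_contra hcon
    push Not at hcon
    obtain ⟨n12, n13, n23⟩ := hcon
    obtain ⟨q, hqQ, hq⟩ := RTree.Sub.inter R hAsub (R.sub_bags B hBsub X ⟨t₁, h1.1⟩)
      ⟨t₁, a1, h1.1⟩
    let Q := (hQfin X hX).toFinset
    have hQ : ∀ t, t ∈ Q ↔ t ∈ A ∧ X ⊆ B t := by intro t; simp [Q]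
    have hlab : ∀ t, t ∈ Q → t ≠ q → ∃ s, G.dist r s < i ∧ s ∈ D.bag t ∧ s ∈ D.bag (R.p t) := by
      intro t ht htq
      obtain ⟨g1, g2⟩ := hq t ((hQ t).1 ht) htq
      exact hlabel t ((hQ t).1 ht).1 g1 g2.1
    have : Nonempty V := ⟨r⟩
    choose! lab hlab1 using hlab
    have hpQ : ∀ t, t ∈ Q → t ≠ q → t ≠ R.root ∧ R.p t ∈ Q := by
      intro t ht htq
      obtain ⟨g1, g2⟩ := hq t ((hQ t).1 ht) htq
      exact ⟨g1, (hQ _).2 g2⟩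
    have hinj : Set.InjOn lab (Q.erase q : Finset D.ι) := by
      intro x hx y hy hxy
      rw [Finset.mem_coe, Finset.mem_erase] at hx hy
      obtain ⟨x1, x2⟩ := hpQ x hx.2 hx.1
      obtain ⟨y1, y2⟩ := hpQ y hy.2 hy.1
      obtain ⟨l1, l2, l3⟩ := hlab1 x hx.2 hx.1
      obtain ⟨k1, k2, k3⟩ := hlab1 y hy.2 hy.1
      rw [← hxy] at k1 k2 k3
      have dx := R.hd x x1
      have dy := R.hd y y1
      have c1 := hXs X hX _ l1 x (R.p x) y ((hQ _).1 hx.2).2 ((hQ _).1 x2).2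
        ((hQ _).1 hy.2).2 l2 l3 k2
      have c2 := hXs X hX _ l1 y (R.p y) x ((hQ _).1 hy.2).2 ((hQ _).1 y2).2
        ((hQ _).1 hx.2).2 k2 k3 l2
      rcases c1 with c1 | c1 | c1
      · rw [← c1] at dx; omega
      · exact c1
      · rcases c2 with c2 | c2 | c2
        · rw [← c2] at dy; omega
        · exact c2.symm
        · rw [c1] at dx; rw [c2] at dy; omega
    have hcount : ∑ t ∈ Q, (L t).card = ∑ s : V, (Q.filter (fun t => s ∈ L t)).card := by
      simp only [Finset.card_filter]
      rw [Finset.sum_comm]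
      refine Finset.sum_congr rfl fun t _ => ?_
      rw [← Finset.card_filter]
      congr 1
      ext s; simp
    have hlow : 2 * (Q.card - 1) ≤ ∑ t ∈ Q, (L t).card := by
      rw [hcount]
      calc 2 * (Q.card - 1) = ∑ s ∈ (Q.erase q).image lab, 2 := by
            rw [Finset.sum_const, Finset.card_image_of_injOn hinj,
              Finset.card_erase_of_mem ((hQ q).2 hqQ), smul_eq_mul, mul_comm]
        _ ≤ ∑ s ∈ (Q.erase q).image lab, (Q.filter (fun t => s ∈ L t)).card := by
            refine Finset.sum_le_sum fun s hs' => ?_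
            obtain ⟨t, ht, rfl⟩ := Finset.mem_image.1 hs'
            rw [Finset.mem_erase] at ht
            obtain ⟨x1, x2⟩ := hpQ t ht.2 ht.1
            obtain ⟨l1, l2, l3⟩ := hlab1 t ht.2 ht.1
            have hne : t ≠ R.p t := fun e => by
              have := R.hd t x1
              rw [← e] at this; omega
            rw [← Finset.card_pair hne]
            apply Finset.card_le_card
            intro y hy
            rw [Finset.mem_insert, Finset.mem_singleton] at hy
            rw [Finset.mem_filter, hL]
            rcases hy with rfl | rfl
            · exact ⟨ht.2, l1, l2⟩
            · exact ⟨x2, l1, l3⟩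
        _ ≤ ∑ s : V, (Q.filter (fun t => s ∈ L t)).card :=
            Finset.sum_le_sum_of_subset (Finset.subset_univ _)
    have hst : ∀ t, X ⊂ B t → (L t).card ≤ 1 := by
      intro t ht
      have := Finset.card_lt_card ht
      have := hBL t
      omega
    have hup : ∑ t ∈ Q, ((L t).card + if t ∈ ({t₁, t₂, t₃} : Finset D.ι) then 1 else 0)
        ≤ ∑ t ∈ Q, 2 := by
      refine Finset.sum_le_sum fun t ht => ?_
      split_ifs with hh
      · simp only [Finset.mem_insert, Finset.mem_singleton] at hh
        rcases hh with rfl | rfl | rfl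
        · have := hst _ h1; omega
        · have := hst _ h2; omega
        · have := hst _ h3; omega
      · have := Finset.card_le_card ((hQ t).1 ht).2
        have := hBL t
        omega
    rw [Finset.sum_add_distrib, ← Finset.card_filter, Finset.sum_const, smul_eq_mul] at hup
    have h3c : (3 : ℕ) ≤ (Q.filter (fun t => t ∈ ({t₁, t₂, t₃} : Finset D.ι))).card := by
      rw [← Finset.card_eq_three.2 ⟨t₁, t₂, t₃, n12, n13, n23, rfl⟩]
      apply Finset.card_le_card
      intro t ht
      rw [Finset.mem_filter]
      refine ⟨?_, ht⟩
      simp only [Finset.mem_insert, Finset.mem_singleton] at ht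
      rcases ht with rfl | rfl | rfl
      · exact (hQ _).2 ⟨a1, h1.1⟩
      · exact (hQ _).2 ⟨a2, h2.1⟩
      · exact (hQ _).2 ⟨a3, h3.1⟩
    omega
  have hmeet : ∀ v : W, ({t | v.1 ∈ D.bag t} ∩ A).Nonempty := by
    intro v
    have hv : G.dist r v.1 = i := v.2
    have hvr : v.1 ≠ r := by
      intro e
      rw [e, SimpleGraph.dist_self] at hv
      omega
    obtain ⟨s, hadj, hlt⟩ := exists_closer G hG r v.1 hvr
    obtain ⟨c, hc1, hc2⟩ := D.edge_cover hadj
    exact ⟨c, hc1, s, by omega, hc2⟩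
  obtain ⟨z, hzA, hz⟩ := hAsub
  have hfinal : {t : {t // t ∈ A} | (B t.1).card = m}.Finite := by
    have h1 : {t | t ∈ A ∧ (B t).card = m}.Finite := by
      have : {t | t ∈ A ∧ (B t).card = m} ⊆
          ⋃ X : {X : Finset W // X.card = m}, {t | t ∈ A ∧ X.1 ⊆ B t} := by
        rintro t ⟨g1, g2⟩
        exact Set.mem_iUnion.2 ⟨⟨B t, g2⟩, g1, subset_rfl⟩
      refine Set.Finite.subset (Set.finite_iUnion ?_) this
      intro X
      exact hQfin X.1 X.2
    refine (h1.preimage (f := Subtype.val) Subtype.val_injective.injOn).subset ?_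
    intro t ht
    exact ⟨t.2, ht⟩
  refine reduce_aux (G.induce {v | G.dist r v = i}) m _ {t // t ∈ A} (R.restrict A z hzA hz)
    (fun t => B t.1) ?_ ?_ ?_ ?_ ?_ hfinal le_rfl
  · intro v
    obtain ⟨t, h1, h2⟩ := hmeet v
    exact ⟨⟨t, h2⟩, (hB _ _).2 h1⟩
  · intro u v huv
    obtain ⟨c, hc1, hc2⟩ := D.edge_cover (show G.Adj u.1 v.1 from huv)
    obtain ⟨t, ⟨h1, h2⟩, h3⟩ := RTree.Sub.helly R (hTv u.1) (hTv v.1) ⟨z, hzA, hz⟩ ⟨c, hc1, hc2⟩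
      (hmeet v) (hmeet u)
    exact ⟨⟨t, h3⟩, (hB _ _).2 h1, (hB _ _).2 h2⟩
  · intro v
    have := R.restrict_sub A z hzA hz (hTv v.1) (hmeet v)
    simpa only [hB, Set.mem_ofPred_eq] using this
  · rintro ⟨t, s, hs1, hs2⟩
    have h1 := hBL t
    have h2 : 0 < (L t).card := Finset.card_pos.2 ⟨s, (hL _ _).2 ⟨hs1, hs2⟩⟩
    show (B t).card ≤ m + 1
    omega
  · intro X hX t₁ t₂ t₃ h1 h2 h3
    rcases hstrict X hX t₁.1 t₁.2 t₂.1 t₂.2 t₃.1 t₃.2 h1 h2 h3 with h | h | h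
    · exact Or.inl (Subtype.ext h)
    · exact Or.inr (Or.inl (Subtype.ext h))
    · exact Or.inr (Or.inr (Subtype.ext h))

theorem layer_zero {V : Type} (G : SimpleGraph V) (hG : G.Connected) (m : ℕ) (r : V) :
    HasSimpleTreewidthLE (G.induce {v | G.dist r v = 0}) m := by
  have hsub : ∀ v : {v | G.dist r v = 0}, v.1 = r := by
    intro v
    have h : G.dist r v.1 = 0 := v.2
    exact ((hG.dist_eq_zero_iff).1 h).symm
  have : Subsingleton {v | G.dist r v = 0} :=
    ⟨fun a b => Subtype.ext ((hsub a).trans (hsub b).symm)⟩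
  let R : RTree Unit := ⟨(), id, fun _ => 0, fun x h => absurd rfl h, rfl⟩
  refine ⟨⟨Unit, R.graph, R.graph_connected, R.graph_acyclic, fun _ => Set.univ, ?_, ?_, ?_⟩, ?_, ?_⟩
  · intro v; exact ⟨(), trivial⟩
  · intro u v _; exact ⟨(), trivial, trivial⟩
  · rintro v ⟨a, _⟩ ⟨b, _⟩
    exact SimpleGraph.Reachable.refl _
  · intro t
    have h1 := Set.ncard_le_one_of_subsingleton (Set.univ : Set {v | G.dist r v = 0})
    exact h1.trans (by omega)
  · intro X _ t₁ t₂ t₃ _ _ _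
    exact Or.inl rfl

/-- If `G` is a connected graph of simple treewidth `k ≥ 1` and `(V_0, V_1, …)` is the
BFS-layering of `G` rooted at `r` (layer `V_i` consists of the vertices at distance exactly
`i` from `r`), then each layer induces a graph of simple treewidth at most `k - 1`. -/
theorem simpleTreewidth_layer {V : Type} [Fintype V] (G : SimpleGraph V)
    (hG : G.Connected) (k : ℕ) (hk : 1 ≤ k) (hstw : simpleTreewidth G = k)
    (r : V) (i : ℕ) :
    simpleTreewidth (G.induce {v | G.dist r v = i}) ≤ k - 1 := by
  obtain ⟨m, rfl⟩ : ∃ m, k = m + 1 := ⟨k - 1, by omega⟩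
  have hne : {k | HasSimpleTreewidthLE G k}.Nonempty := by
    by_contra hcon
    rw [Set.not_nonempty_iff_eq_empty] at hcon
    rw [simpleTreewidth, hcon, Nat.sInf_empty] at hstw
    omega
  have hmem := Nat.sInf_mem hne
  rw [show sInf {k | HasSimpleTreewidthLE G k} = m + 1 from hstw] at hmem
  apply Nat.sInf_le
  show HasSimpleTreewidthLE _ m
  rcases Nat.eq_zero_or_pos i with rfl | hi
  · exact layer_zero G hG m r
  · exact layer_pos G hG m hmem r i hi
end
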